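/- arXiv:1506.05540 — 2 statements merged into one kernel-verified Lean document; each statement's English description precedes it below -/
import Mathlib

section
/- Every 2-connected claw-o-heavy and P6-γ3-heavy graph is hamiltonian, where γ3 is the graph on I = {1,2,3,4,5,6} with edge set E(γ3) = {13,14,15,25,26,36,46}. -/
/-- A graph is 2-connected if it has at least 3 vertices and deleting any
single vertex leaves a connected graph. -/
def TwoConnected {V : Type*} [Fintype V] (G : SimpleGraph V) : Prop :=
  3 ≤ Fintype.card V ∧ ∀ v : V, (G.induce ({v}ᶜ : Set V)).Connected

/-- A graph `G` of order `n` is claw-o-heavy if every induced copy of the claw `K_{1,3}`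
(with center `a` and leaves `b₁, b₂, b₃`) contains two nonadjacent vertices whose
degree sum in `G` is at least `n`. -/
def ClawOHeavy {V : Type*} [Fintype V] (G : SimpleGraph V) [DecidableRel G.Adj] : Prop :=
  ∀ a b₁ b₂ b₃ : V, b₁ ≠ b₂ → b₁ ≠ b₃ → b₂ ≠ b₃ →
    G.Adj a b₁ → G.Adj a b₂ → G.Adj a b₃ →
    ¬ G.Adj b₁ b₂ → ¬ G.Adj b₁ b₃ → ¬ G.Adj b₂ b₃ →
    ∃ u v : V, u ∈ ({a, b₁, b₂, b₃} : Set V) ∧ v ∈ ({a, b₁, b₂, b₃} : Set V) ∧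
      u ≠ v ∧ ¬ G.Adj u v ∧ Fintype.card V ≤ G.degree u + G.degree v

/-- `v 0, v 1, …, v 5` is an induced path on 6 vertices in `G`. -/
def IsInducedP6 {V : Type*} (G : SimpleGraph V) (v : Fin 6 → V) : Prop :=
  Function.Injective v ∧
    ∀ i j : Fin 6, G.Adj (v i) (v j) ↔ (i.val + 1 = j.val ∨ j.val + 1 = i.val)

/- The paper indexes the vertices of `P₆` by `I = {1,…,6}`; here we use `Fin 6 = {0,…,5}`
(so paper-index `i` corresponds to `i - 1 : Fin 6`).  A graph (possibly with loops) on `I`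
is modelled as a set of unordered pairs (`Sym2 (Fin 6)`); a loop at `i` is `s(i, i)`. -/

/-- `γ` is symmetrical: `ij ∈ E(γ)` iff `(7-i)(7-j) ∈ E(γ)` (in `Fin 6` terms,
the map `i ↦ 7 - i` on `{1,…,6}` is `Fin.rev : i ↦ 5 - i`). -/
def SymmetricalGamma (γ : Set (Sym2 (Fin 6))) : Prop :=
  ∀ e : Sym2 (Fin 6), e ∈ γ ↔ e.map Fin.rev ∈ γ

/-- A graph `G` of order `n` is `P₆`-`γ`-heavy if for every induced path
`v 0, …, v 5` on 6 vertices there is an edge (or loop) `ij` of `γ` with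
`d(v i) + d(v j) ≥ n`. -/
def P6GammaHeavy {V : Type*} [Fintype V] (G : SimpleGraph V) [DecidableRel G.Adj]
    (γ : Set (Sym2 (Fin 6))) : Prop :=
  ∀ v : Fin 6 → V, IsInducedP6 G v →
    ∃ i j : Fin 6, s(i, j) ∈ γ ∧ Fintype.card V ≤ G.degree (v i) + G.degree (v j)

/-- `γ₁`, with paper edge set `{14,15,16,24,25,26,34,35,36}`. -/
def gamma1 : Set (Sym2 (Fin 6)) :=
  {s(0,3), s(0,4), s(0,5), s(1,3), s(1,4), s(1,5), s(2,3), s(2,4), s(2,5)}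

/-- `γ₂`, with paper edge set `{11,12,14,15,16,25,26,36,56,66}`. -/
def gamma2 : Set (Sym2 (Fin 6)) :=
  {s(0,0), s(0,1), s(0,3), s(0,4), s(0,5), s(1,4), s(1,5), s(2,5), s(4,5), s(5,5)}

/-- `γ₃`, with paper edge set `{13,14,15,25,26,36,46}`. -/
def gamma3 : Set (Sym2 (Fin 6)) :=
  {s(0,2), s(0,3), s(0,4), s(1,4), s(1,5), s(2,5), s(3,5)}

section

open SimpleGraph

variable {V : Type*}

/-- `l` is the list of vertices of a walk of `G` from `a` to `b`. -/
def WalkList (G : SimpleGraph V) (a : V) (l : List V) (b : V) : Prop :=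
  l.IsChain G.Adj ∧ l.head? = some a ∧ l.getLast? = some b

/-- `l` is the list of vertices of a cycle of `G`, where a single edge counts as a cycle. -/
def IsCycleList (G : SimpleGraph V) (l : List V) : Prop :=
  l.Nodup ∧ ∃ a b, WalkList G a l b ∧ G.Adj b a

/-- `G` has a Hamilton cycle, given as a list of vertices. -/
def HasHamCycle (G : SimpleGraph V) : Prop :=
  ∃ l, IsCycleList G l ∧ ∀ v, v ∈ l

namespace WalkList

variable {G H : SimpleGraph V} {a b c d x : V} {l m : List V}

lemma single (G : SimpleGraph V) (a : V) : WalkList G a [a] a := by simp [WalkList]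

lemma ne_nil (h : WalkList G a l b) : l ≠ [] := by
  rintro rfl; simp [WalkList] at h

lemma append (h : WalkList G a l b) (hbc : G.Adj b c) (h' : WalkList G c m d) :
    WalkList G a (l ++ m) d := by
  obtain ⟨h1, h2, h3⟩ := h
  obtain ⟨k1, k2, k3⟩ := h'
  refine ⟨h1.append k1 ?_, by simp [h2], by simp [k3]⟩
  rintro x hx y hy
  simp_all

lemma reverse (h : WalkList G a l b) : WalkList G b l.reverse a := by
  obtain ⟨h1, h2, h3⟩ := h
  refine ⟨?_, by simpa using h3, by simpa using h2⟩
  rw [List.isChain_reverse]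
  exact h1.imp fun _ _ h => h.symm

lemma mono (hGH : G ≤ H) (h : WalkList G a l b) : WalkList H a l b :=
  ⟨h.1.imp fun _ _ h => hGH h, h.2⟩

lemma head_mem (h : WalkList G a l b) : a ∈ l := List.mem_of_head? h.2.1

lemma last_mem (h : WalkList G a l b) : b ∈ l := List.mem_of_getLast? h.2.2

lemma split (h : WalkList G a (l ++ m) d) (hl : l ≠ []) (hm : m ≠ []) :
    ∃ b c, WalkList G a l b ∧ G.Adj b c ∧ WalkList G c m d := by
  obtain ⟨h1, h2, h3⟩ := h
  rw [List.isChain_append] at h1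
  obtain ⟨i1, i2, i3⟩ := h1
  obtain ⟨b, hb⟩ : ∃ b, l.getLast? = some b := ⟨_, List.getLast?_eq_some_getLast hl⟩
  obtain ⟨c, hc⟩ : ∃ c, m.head? = some c := ⟨_, List.head?_eq_some_head hm⟩
  refine ⟨b, c, ⟨i1, ?_, hb⟩, i3 b hb c hc, ⟨i2, hc, ?_⟩⟩
  · rw [List.head?_append_of_ne_nil _ hl] at h2; exact h2
  · rw [List.getLast?_append_of_ne_nil _ hm] at h3; exact h3

lemma eq_of_singleton (h : WalkList G a [c] b) : a = c ∧ b = c := by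
  simp [WalkList] at h; exact ⟨h.1.symm, h.2.symm⟩

lemma exists_cons (h : WalkList G a l b) : ∃ t, l = a :: t := by
  obtain ⟨h1, h2, h3⟩ := h
  cases l with
  | nil => simp at h2
  | cons c t => exact ⟨t, by simp_all⟩

/-- Split a walk just before one of its vertices. -/
lemma split_before (h : WalkList G a l b) (hx : x ∈ l) (hxa : x ≠ a) :
    ∃ l₁ l₂ p, l = l₁ ++ l₂ ∧ WalkList G a l₁ p ∧ G.Adj p x ∧ WalkList G x l₂ b := by
  obtain ⟨l₁, l₂, rfl⟩ := List.append_of_mem hx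
  have hl : l₁ ≠ [] := by
    rintro rfl
    have := h.2.1
    simp_all
  obtain ⟨p, q, h1, h2, h3⟩ := h.split hl (by simp)
  obtain rfl : x = q := by simpa using h3.2.1
  exact ⟨l₁, x :: l₂, p, rfl, h1, h2, h3⟩

/-- Split a walk around one of its inner vertices. -/
lemma split_around (h : WalkList G a l b) (hx : x ∈ l) (hxa : x ≠ a) (hxb : x ≠ b) :
    ∃ l₁ l₂ p q, l = l₁ ++ ([x] ++ l₂) ∧ WalkList G a l₁ p ∧ G.Adj p x ∧ G.Adj x q ∧
      WalkList G q l₂ b := by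
  obtain ⟨l₁, l₂, p, rfl, h1, h2, h3⟩ := h.split_before hx hxa
  obtain ⟨t, rfl⟩ := h3.exists_cons
  have ht : t ≠ [] := by
    rintro rfl
    exact hxb h3.eq_of_singleton.2.symm
  obtain ⟨p', q, h4, h5, h6⟩ := WalkList.split (l := [x]) (m := t) h3 (by simp) ht
  obtain rfl := h4.eq_of_singleton.2
  exact ⟨l₁, t, p, q, rfl, h1, h2, h5, h6⟩

lemma exists_walk (h : WalkList G a l b) : ∃ p : G.Walk a b, p.support = l := by
  have hne := h.ne_nil
  obtain ⟨h1, h2, h3⟩ := h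
  obtain rfl : l.head hne = a := by
    rw [List.head?_eq_some_head hne] at h2; simpa using h2
  obtain rfl : l.getLast hne = b := by
    rw [List.getLast?_eq_some_getLast hne] at h3; simpa using h3
  exact ⟨SimpleGraph.Walk.ofSupport l hne h1, SimpleGraph.Walk.support_ofSupport ..⟩

lemma _root_.SimpleGraph.Walk.walkList_support (p : G.Walk a b) : WalkList G a p.support b := by
  refine ⟨p.isChain_adj_support, ?_, ?_⟩
  · rw [List.head?_eq_some_head p.support_ne_nil]; simp
  · rw [List.getLast?_eq_some_getLast p.support_ne_nil]; simp

end WalkList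

lemma IsCycleList.rotate {G : SimpleGraph V} {l m : List V} (h : IsCycleList G (l ++ m)) :
    IsCycleList G (m ++ l) := by
  rcases eq_or_ne l [] with rfl | hl
  · simpa using h
  rcases eq_or_ne m [] with rfl | hm
  · simpa using h
  obtain ⟨hn, a, b, h, hab⟩ := h
  obtain ⟨c, d, h1, h2, h3⟩ := h.split hl hm
  exact ⟨List.perm_append_comm.nodup_iff.1 hn, d, c, h3.append hab h1, h2⟩

/-- A closed rearrangement of a spanning duplicate-free list is a Hamilton cycle. -/
lemma HasHamCycle.of_perm {G : SimpleGraph V} {l m : List V} {a b : V} (hl : l.Nodup)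
    (hs : ∀ v, v ∈ l) (hm : WalkList G a m b) (hba : G.Adj b a) (hp : m.Perm l) :
    HasHamCycle G :=
  ⟨m, ⟨hp.nodup_iff.2 hl, a, b, hm, hba⟩, fun v => hp.mem_iff.2 (hs v)⟩

lemma HasHamCycle.isHamiltonian [Fintype V] [DecidableEq V] {G : SimpleGraph V}
    (h : HasHamCycle G) (hV : 3 ≤ Fintype.card V) : G.IsHamiltonian := by
  obtain ⟨l, ⟨hn, a, b, hl, hba⟩, hs⟩ := h
  obtain ⟨p, rfl⟩ := hl.exists_walk
  intro _
  have hp : p.IsPath := SimpleGraph.Walk.IsPath.mk' hn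
  have hh : p.IsHamiltonian := hp.isHamiltonian_of_mem hs
  have hlen := hh.length_eq
  refine ⟨b, SimpleGraph.Walk.cons hba p, ?_⟩
  rw [SimpleGraph.Walk.isHamiltonianCycle_iff_isCycle_and_length_eq]
  constructor
  · rw [SimpleGraph.Walk.isCycle_iff_isPath_tail_and_le_length]
    exact ⟨by simpa using hp, by simp; omega⟩
  · simp; omega

/-- Adding an edge to `M` creates a Hamilton cycle, hence `M` has a Hamilton path joining the
ends of that edge. -/
lemma exists_hamPath_of_sup_edge [Fintype V] {M : SimpleGraph V} {p q : V}
    (hV : 3 ≤ Fintype.card V) (hM : ¬ HasHamCycle M) (h : HasHamCycle (M ⊔ edge p q)) :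
    ∃ l, WalkList M p l q ∧ l.Nodup ∧ ∀ v, v ∈ l := by
  have hadj : ∀ a b, (M ⊔ edge p q).Adj a b → ¬ M.Adj a b → (a = p ∧ b = q) ∨ (a = q ∧ b = p) := by
    intro a b h h'
    rw [sup_adj, edge_adj] at h
    tauto
  -- it suffices to have a Hamilton cycle whose closing edge is new
  suffices H : ∃ l a b, WalkList (M ⊔ edge p q) a l b ∧ (M ⊔ edge p q).Adj b a ∧ ¬ M.Adj b a ∧
      l.Nodup ∧ ∀ v, v ∈ l by
    obtain ⟨l, a, b, hl, hba, hnba, hn, hs⟩ := H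
    have hMl : WalkList M a l b := by
      refine ⟨?_, hl.2⟩
      rw [List.isChain_iff_forall_rel_of_append_cons_cons]
      intro c d l₁ l₂ e
      by_contra hcd
      have hcd' : (M ⊔ edge p q).Adj c d :=
        List.isChain_iff_forall_rel_of_append_cons_cons.1 hl.1 e
      have h1 := hadj _ _ hba hnba
      have h2 := hadj _ _ hcd' hcd
      have h3 : (c = a ∧ d = b) ∨ (c = b ∧ d = a) := by grind
      subst e
      have ha := hl.2.1
      have hb := hl.2.2
      rcases h3 with ⟨rfl, rfl⟩ | ⟨rfl, rfl⟩
      · have e1 : l₁ = [] := by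
          cases l₁ with
          | nil => rfl
          | cons t l₁ => simp at ha; subst ha; simp at hn
        subst e1
        have e2 : l₂ = [] := by
          by_contra hne
          obtain ⟨t, x, rfl⟩ := List.eq_nil_or_concat l₂ |>.resolve_left hne
          rw [List.concat_eq_append, List.nil_append, ← List.cons_append, ← List.cons_append,
            List.getLast?_concat] at hb
          simp at hb
          subst hb
          simp at hn
        subst e2
        have := Fintype.card_le_of_surjective (fun i : Fin 2 => if i = 0 then c else d) (by
          intro v
          have := hs v
          simp at this
          rcases this with rfl | rfl
          · exact ⟨0, by simp⟩
          · exact ⟨1, by simp⟩)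
        simp at this
        omega
      · cases l₁ with
        | nil => simp at ha; subst ha; simp at hn
        | cons t l₁ => simp at ha; subst ha; simp at hn
    rcases hadj _ _ hba hnba with ⟨rfl, rfl⟩ | ⟨rfl, rfl⟩
    · exact ⟨_, hMl.reverse, by simpa using hn, by simpa using hs⟩
    · exact ⟨_, hMl, hn, hs⟩
  obtain ⟨l, ⟨hn, a, b, hl, hba⟩, hs⟩ := h
  by_cases hc : M.Adj b a
  · have : ¬ l.IsChain M.Adj := fun h => hM ⟨l, ⟨hn, a, b, ⟨h, hl.2⟩, hc⟩, hs⟩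
    rw [List.isChain_iff_forall_rel_of_append_cons_cons] at this
    push Not at this
    obtain ⟨c, d, l₁, l₂, rfl, hcd⟩ := this
    obtain ⟨c', d', h1, h2, h3⟩ := WalkList.split (l := l₁ ++ [c]) (m := d :: l₂)
      (by simpa using hl) (by simp) (by simp)
    obtain rfl : c = c' := by simpa using h1.2.2
    obtain rfl : d = d' := by simpa using h3.2.1
    refine ⟨_, _, _, h3.append hba h1, h2, hcd, ?_, fun v => ?_⟩
    · rw [List.perm_append_comm.nodup_iff]; simpa using hn
    · have := hs v
      simp at this ⊢; tauto
  · exact ⟨l, a, b, hl, hba, hc, hn, hs⟩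

/-- The degree of `v`, without decidability assumptions. -/
noncomputable def dg (G : SimpleGraph V) (v : V) : ℕ := (G.neighborSet v).ncard

lemma dg_mono [Finite V] {G H : SimpleGraph V} (h : G ≤ H) (v : V) : dg G v ≤ dg H v :=
  Set.ncard_le_ncard (fun _ hw => h hw) (Set.toFinite _)

/-- Ore's lemma. -/
lemma hasHamCycle_of_sup_edge [Fintype V] {M : SimpleGraph V} {p q : V}
    (hV : 3 ≤ Fintype.card V) (hpq : Fintype.card V ≤ dg M p + dg M q)
    (h : HasHamCycle (M ⊔ edge p q)) : HasHamCycle M := by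
  classical
  by_contra hM
  obtain ⟨l, hl, hn, hs⟩ := exists_hamPath_of_sup_edge hV hM h
  have hlen : l.length = Fintype.card V := by
    rw [← List.toFinset_card_of_nodup hn, ← Finset.card_univ]
    congr 1
    ext v; simp [hs v]
  have hne := hl.ne_nil
  have h0 : l[0]'(by omega) = p := by
    have := hl.2.1
    rw [List.head?_eq_getElem?, List.getElem?_eq_some_iff] at this
    exact this.2
  have h9 : l[l.length - 1]'(by omega) = q := by
    have := hl.2.2
    rw [List.getLast?_eq_getElem?, List.getElem?_eq_some_iff] at this
    exact this.2
  have hget : ∀ v, ∃ i, l[i]? = some v := fun v => List.mem_iff_getElem?.1 (hs v)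
  choose f hf using hget
  have hf' : ∀ v, ∃ h : f v < l.length, l[f v] = v := fun v => by
    simpa [List.getElem?_eq_some_iff] using hf v
  have hinj : Function.Injective f := fun v w e => by
    have h1 := hf v
    rw [e, hf w] at h1
    simpa using h1.symm
  set A : Finset ℕ := (Set.toFinset (M.neighborSet p)).image (fun v => f v - 1)
  set B : Finset ℕ := (Set.toFinset (M.neighborSet q)).image f
  have fp : ∀ v, M.Adj p v → f v ≠ 0 := fun v hv e => by
    obtain ⟨h1, h2⟩ := hf' v
    simp only [e] at h2
    exact hv.ne (h0.symm.trans h2)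
  have fq : ∀ v, M.Adj q v → f v ≠ l.length - 1 := fun v hv e => by
    obtain ⟨h1, h2⟩ := hf' v
    simp only [e] at h2
    exact hv.ne (h9.symm.trans h2)
  have hA : A.card = dg M p := by
    rw [Finset.card_image_of_injOn, dg, Set.ncard_eq_toFinset_card']
    intro v hv w hw e
    simp at hv hw e
    have := fp v hv
    have := fp w hw
    exact hinj (by omega)
  have hB : B.card = dg M q := by
    rw [Finset.card_image_of_injective _ hinj, dg, Set.ncard_eq_toFinset_card']
  have hsub : A ∪ B ⊆ Finset.range (l.length - 1) := by
    intro i hi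
    simp only [A, B, Finset.mem_union, Finset.mem_image, Set.mem_toFinset, mem_neighborSet] at hi
    rw [Finset.mem_range]
    rcases hi with ⟨v, hv, rfl⟩ | ⟨v, hv, rfl⟩
    · have := fp v hv
      have := (hf' v).1
      omega
    · have := fq v hv
      have := (hf' v).1
      omega
  have hcard := Finset.card_le_card hsub
  have hint : (A ∩ B).Nonempty := by
    rw [← Finset.card_pos]
    have := Finset.card_union_add_card_inter A B
    simp at hcard
    omega
  obtain ⟨i, hi⟩ := hint
  simp only [A, B, Finset.mem_inter, Finset.mem_image, Set.mem_toFinset, mem_neighborSet] at hi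
  obtain ⟨⟨v, hv, h1⟩, w, hw, h2⟩ := hi
  have hfv := fp v hv
  obtain ⟨hv1, hv2⟩ := hf' v
  obtain ⟨hw1, hw2⟩ := hf' w
  obtain ⟨c, d, k1, k2, k3⟩ := WalkList.split (l := l.take (f v)) (m := l.drop (f v))
    (by simpa using hl) (by simp [hfv, hne]) (by simp; omega)
  obtain rfl : v = d := by
    have := k3.2.1
    rw [List.head?_eq_getElem?] at this
    simp at this
    rw [hf v] at this; simpa using this
  obtain rfl : w = c := by
    have := k1.2.2
    rw [List.getLast?_eq_getElem?] at this
    have e : (List.take (f v) l).length - 1 = f w := by simp; omega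
    rw [e, List.getElem?_take_of_lt (by omega), hf w] at this
    simpa using this
  exact hM (.of_perm hn hs (k1.append hw.symm k3.reverse) hv.symm
    (((List.reverse_perm _).append_left _).trans (by simp)))

/-- Degree sum bound for two nonadjacent vertices whose common neighbours can be matched into the
set of vertices that are neighbours of neither. -/
lemma dg_add_dg_lt [Fintype V] {G : SimpleGraph V} {a b : V} (hab : a ≠ b) (hnab : ¬ G.Adj a b)
    (f : V → V) (hf : ∀ c, G.Adj a c → G.Adj b c → f c ≠ a ∧ f c ≠ b ∧ ¬ G.Adj a (f c) ∧
      ¬ G.Adj b (f c))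
    (hinj : ∀ c d, G.Adj a c → G.Adj b c → G.Adj a d → G.Adj b d → f c = f d → c = d) :
    dg G a + dg G b < Fintype.card V := by
  classical
  set A := G.neighborSet a
  set B := G.neighborSet b
  have h1 := Set.ncard_union_add_ncard_inter A B
  have h2 : (A ∩ B).ncard ≤ ((insert a (insert b (A ∪ B)))ᶜ : Set V).ncard := by
    refine Set.ncard_le_ncard_of_injOn f ?_ ?_ (Set.toFinite _)
    · rintro c ⟨hc1, hc2⟩
      have := hf c hc1 hc2
      simp [A, B]; tauto
    · rintro c ⟨hc1, hc2⟩ d ⟨hd1, hd2⟩ e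
      exact hinj c d hc1 hc2 hd1 hd2 e
  have h3 := Set.ncard_add_ncard_compl (insert a (insert b (A ∪ B)))
  rw [Set.ncard_insert_of_notMem (by simp [A, B, hab, adj_comm, hnab]),
    Set.ncard_insert_of_notMem (by simp [A, B, hnab]), Nat.card_eq_fintype_card] at h3
  change A.ncard + B.ncard < _
  omega

/-- Among any three neighbours in `H` of a vertex, two are adjacent in `B`. -/
def ClawIn (H B : SimpleGraph V) : Prop :=
  ∀ y a b c, H.Adj y a → H.Adj y b → H.Adj y c → a ≠ b → a ≠ c → b ≠ c →
    B.Adj a b ∨ B.Adj a c ∨ B.Adj b c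

/-- The exchange argument at a vertex `x` of a Hamilton path, one side of `x`. -/
lemma exchange_left {H M B : SimpleGraph V} {x u v p q z : V} {l₁ l₂ : List V}
    (hHM : H ≤ M) (hMB : M ≤ B)
    (hMx : ∀ a b, M.Adj a b → H.Adj a b ∨ (H.Adj x a ∧ H.Adj x b))
    (hB : ¬ HasHamCycle B) (hclaw : ClawIn H B)
    (h₁ : WalkList M u l₁ p) (hpx : M.Adj p x) (hxq : M.Adj x q) (h₂ : WalkList M q l₂ v)
    (hn : (l₁ ++ ([x] ++ l₂)).Nodup) (hs : ∀ w, w ∈ l₁ ++ ([x] ++ l₂))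
    (hxu : H.Adj x u) (hxv : H.Adj x v)
    (hz : z ∈ l₁) (hzx : B.Adj z x) (hzu : B.Adj z u) (hzv : B.Adj z v)
    (hcase : H.Adj x z ∨ (¬ H.Adj x z ∧ H.Adj z u ∧ H.Adj z v)) : False := by
  classical
  have hHB := hHM.trans hMB
  have key : ∀ {m : List V} {c d : V}, WalkList B c m d → B.Adj d c →
      m.Perm (l₁ ++ ([x] ++ l₂)) → False := fun hm hdc hp => hB (.of_perm hn hs hm hdc hp)
  have hMx' : ∀ a, M.Adj x a → H.Adj x a := fun a h => by
    rcases hMx _ _ h with h | h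
    · exact h
    · exact h.2
  have k₁ := h₁.mono hMB
  have k₂ := h₂.mono hMB
  have hpv : ¬ B.Adj p v := fun h => key
    ((k₁.append h k₂.reverse).append (hMB hxq.symm) (.single B x)) (hHB hxu)
    (by rw [List.perm_iff_count]; intro; simp only [List.count_append, List.count_reverse]; omega)
  have huv : ¬ B.Adj u v := fun h => key
    ((k₁.append (hMB hpx) (.single B x)).append (hMB hxq) k₂) h.symm (by simp)
  have hpnv : p ≠ v := by
    rintro rfl
    exact List.disjoint_of_nodup_append hn h₁.last_mem (by simp [h₂.last_mem])
  have hup : p ≠ u → B.Adj p u := fun hpu => by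
    have h1 := hMx' _ hpx.symm
    rcases hclaw x p u v h1 hxu hxv hpu hpnv
      (fun e => List.disjoint_of_nodup_append hn h₁.head_mem (by simp [e, h₂.last_mem]))
      with h | h | h
    · exact h
    · exact (hpv h).elim
    · exact (huv h).elim
  have hzp : z ≠ p := by
    rintro rfl; exact hpv hzv
  obtain ⟨m₁, m₂, r, s, rfl, j1, hrz, hzs, j2⟩ := h₁.split_around hz hzu.ne hzp
  have hpu : p ≠ u := by
    rintro rfl
    have : (m₁ ++ ([z] ++ m₂)).Nodup := (List.nodup_append.1 hn).1
    exact List.disjoint_of_nodup_append this j1.head_mem (by simp [j2.last_mem])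
  have hpu := hup hpu
  have i1 := j1.mono hMB
  have i2 := j2.mono hMB
  have hrs : r ≠ s := by
    rintro rfl
    have : (m₁ ++ ([z] ++ m₂)).Nodup := (List.nodup_append.1 hn).1
    exact List.disjoint_of_nodup_append this j1.last_mem (by simp [j2.head_mem])
  have hrx : r ≠ x := by
    rintro rfl
    exact List.disjoint_of_nodup_append hn (by simp [j1.last_mem]) (by simp : r ∈ [r] ++ l₂)
  have hsx : s ≠ x := by
    rintro rfl
    exact List.disjoint_of_nodup_append hn (by simp [j2.head_mem]) (by simp : s ∈ [s] ++ l₂)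
  have hrv : r ≠ v := by
    rintro rfl
    exact List.disjoint_of_nodup_append hn (a := r) (by simp [j1.last_mem]) (by simp [h₂.last_mem])
  have hsv : s ≠ v := by
    rintro rfl
    exact List.disjoint_of_nodup_append hn (a := s) (by simp [j2.head_mem]) (by simp [h₂.last_mem])
  have hrs' : ¬ B.Adj r s := fun h => key
    (((i1.append h i2).append (hMB hpx) ((WalkList.single B x).append (hMB hxq) k₂)).append
      hzv.symm (.single B z)) hzu
    (by rw [List.perm_iff_count]; intro; simp only [List.count_append]; omega)
  rcases hcase with hc | ⟨hc, hcu, hcv⟩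
  · by_cases hsx' : B.Adj s x
    · exact key (((i1.append (hMB hrz) (.single B z)).reverse.append hpu.symm i2.reverse).append
        hsx' ((WalkList.single B x).append (hMB hxq) k₂)) hzv.symm
        (by rw [List.perm_iff_count]; intro
            simp only [List.count_append, List.count_reverse]; omega)
    by_cases hrx' : B.Adj r x
    · exact key ((((WalkList.single B x).append hrx'.symm i1.reverse).append hpu.symm
        ((WalkList.single B z).append (hMB hzs) i2).reverse).append hzv k₂.reverse)
        (hMB hxq.symm) (by rw [List.perm_iff_count]; intro
                           simp only [List.count_append, List.count_reverse]; omega)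
    have hzr : H.Adj z r := by
      rcases hMx _ _ hrz with h | h
      · exact h.symm
      · exact (hrx' (hHB h.1.symm)).elim
    have hzs' : H.Adj z s := by
      rcases hMx _ _ hzs with h | h
      · exact h
      · exact (hsx' (hHB h.2.symm)).elim
    rcases hclaw z r s x hzr hzs' hc.symm hrs hrx hsx with h | h | h <;> contradiction
  · by_cases hsv' : B.Adj s v
    · exact key ((((i1.append (hMB hrz) (.single B z)).reverse.append hpu.symm i2.reverse).append
        hsv' k₂.reverse).append (hMB hxq.symm) (.single B x)) hzx.symm
        (by rw [List.perm_iff_count]; intro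
            simp only [List.count_append, List.count_reverse]; omega)
    by_cases hrv' : B.Adj r v
    · exact key ((i1.reverse.append hpu.symm
        ((WalkList.single B z).append (hMB hzs) i2).reverse).append hzx
          ((WalkList.single B x).append (hMB hxq) k₂)) hrv'.symm
        (by rw [List.perm_iff_count]; intro
            simp only [List.count_append, List.count_reverse])
    have hzr : H.Adj z r := by
      rcases hMx _ _ hrz with h | h
      · exact h.symm
      · exact (hc h.2).elim
    have hzs' : H.Adj z s := by
      rcases hMx _ _ hzs with h | h
      · exact h
      · exact (hc h.1).elim
    rcases hclaw z r s v hzr hzs' hcv hrs hrv hsv with h | h | h <;> contradiction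

/-- The exchange argument at a vertex `x` of a Hamilton path. -/
lemma exchange {H M B : SimpleGraph V} {x u v z : V} {l : List V}
    (hHM : H ≤ M) (hMB : M ≤ B)
    (hMx : ∀ a b, M.Adj a b → H.Adj a b ∨ (H.Adj x a ∧ H.Adj x b))
    (hB : ¬ HasHamCycle B) (hclaw : ClawIn H B)
    (hl : WalkList M u l v) (hn : l.Nodup) (hs : ∀ w, w ∈ l)
    (hxu : H.Adj x u) (hxv : H.Adj x v)
    (hzx : B.Adj z x) (hzu : B.Adj z u) (hzv : B.Adj z v)
    (hcase : H.Adj x z ∨ (¬ H.Adj x z ∧ H.Adj z u ∧ H.Adj z v)) : False := by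
  obtain ⟨l₁, l₂, p, q, rfl, h₁, hpx, hxq, h₂⟩ := hl.split_around (hs x) hxu.ne hxv.ne
  have hz := hs z
  simp only [List.mem_append, List.mem_singleton] at hz
  rcases hz with hz | rfl | hz
  · exact exchange_left hHM hMB hMx hB hclaw h₁ hpx hxq h₂ hn hs hxu hxv hz hzx hzu hzv hcase
  · exact hzx.ne rfl
  · refine exchange_left (l₁ := l₂.reverse) (l₂ := l₁.reverse) hHM hMB hMx hB hclaw h₂.reverse
      hxq.symm hpx.symm h₁.reverse ?_ ?_ hxv hxu (by simpa using hz) hzx hzv hzu (by tauto)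
    · have := List.nodup_reverse.2 hn
      simpa using this
    · intro w
      have := hs w
      simp at this ⊢; tauto

/-- `p` and `q` are adjacent, or distinct with degree sum at least the order of the graph. -/
def OAdj [Fintype V] (H : SimpleGraph V) (p q : V) : Prop :=
  H.Adj p q ∨ (p ≠ q ∧ Fintype.card V ≤ dg H p + dg H q)

lemma OAdj.symm [Fintype V] {H : SimpleGraph V} {p q : V} (h : OAdj H p q) : OAdj H q p := by
  rcases h with h | h
  · exact .inl h.symm
  · exact .inr ⟨h.1.symm, by omega⟩

lemma OAdj.ne [Fintype V] {H : SimpleGraph V} {p q : V} (h : OAdj H p q) : p ≠ q := by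
  rcases h with h | h
  · exact h.ne
  · exact h.1

lemma OAdj.mono [Fintype V] {G H : SimpleGraph V} (hGH : G ≤ H) {p q : V} (h : OAdj G p q) :
    OAdj H p q := by
  rcases h with h | h
  · exact .inl (hGH h)
  · have := dg_mono hGH p
    have := dg_mono hGH q
    exact .inr ⟨h.1, by omega⟩

/-- Among any three neighbours of a vertex, two are adjacent or heavy. -/
def ClawHeavy [Fintype V] (H : SimpleGraph V) : Prop :=
  ∀ y a b c, H.Adj y a → H.Adj y b → H.Adj y c → a ≠ b → a ≠ c → b ≠ c →
    OAdj H a b ∨ OAdj H a c ∨ OAdj H b c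

/-- The neighbourhood of `r` is a clique. -/
def Simplicial (H : SimpleGraph V) (r : V) : Prop :=
  ∀ s t, H.Adj r s → H.Adj r t → s ≠ t → H.Adj s t

/-- `H` with the neighbourhood of `x` completed to a clique. -/
def localCompletion (H : SimpleGraph V) (x : V) : SimpleGraph V where
  Adj a b := H.Adj a b ∨ (a ≠ b ∧ H.Adj x a ∧ H.Adj x b)
  symm := ⟨fun a b h => by
    rcases h with h | h
    · exact .inl h.symm
    · exact .inr ⟨h.1.symm, h.2.2, h.2.1⟩⟩
  loopless := ⟨fun a h => by simp at h⟩

lemma le_localCompletion (H : SimpleGraph V) (x : V) : H ≤ localCompletion H x :=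
  fun _ _ h => .inl h

lemma dg_le_localCompletion [Finite V] {H : SimpleGraph V} {x a : V} (ha : H.Adj x a) :
    dg H x ≤ dg (localCompletion H x) a := by
  classical
  refine Set.ncard_le_ncard_of_injOn (fun v => if v = a then x else v) ?_ ?_ (Set.toFinite _)
  · intro v hv
    by_cases h : v = a
    · simpa [h, localCompletion] using ha.symm
    · simp only [mem_neighborSet] at hv
      simp [h, localCompletion, ha, hv, Ne.symm h]
  · intro v hv w hw e
    have h1 : v ≠ x := fun e => H.loopless.irrefl x (e ▸ hv)
    have h2 : w ≠ x := fun e => H.loopless.irrefl x (e ▸ hw)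
    grind

lemma ClawHeavy.localCompletion [Fintype V] {H : SimpleGraph V} (hH : ClawHeavy H) (x : V) :
    ClawHeavy (localCompletion H x) := by
  have main : ∀ y a b c, (_root_.localCompletion H x).Adj y b →
      (_root_.localCompletion H x).Adj y c → a ≠ b → a ≠ c → b ≠ c → H.Adj x y → H.Adj x a →
      OAdj (_root_.localCompletion H x) a b ∨ OAdj (_root_.localCompletion H x) a c ∨
        OAdj (_root_.localCompletion H x) b c := by
    intro y a b c hb hc hab hac hbc hy ha
    have heavy : ∀ b, a ≠ b → ¬ H.Adj x b → OAdj H x b →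
        OAdj (_root_.localCompletion H x) a b := by
      intro b hab hxb h
      rcases h with h | h
      · contradiction
      · have := dg_le_localCompletion ha
        have := dg_mono (le_localCompletion H x) b
        exact .inr ⟨hab, by omega⟩
    by_cases hxb : H.Adj x b
    · exact .inl (.inl (.inr ⟨hab, ha, hxb⟩))
    by_cases hxc : H.Adj x c
    · exact .inr (.inl (.inl (.inr ⟨hac, ha, hxc⟩)))
    rcases hb with hb | hb
    swap
    · exact (hxb hb.2.2).elim
    rcases hc with hc | hc
    swap
    · exact (hxc hc.2.2).elim
    rcases eq_or_ne x b with rfl | hxb'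
    · exact .inl (.inl (.inl ha.symm))
    rcases eq_or_ne x c with rfl | hxc'
    · exact .inr (.inl (.inl (.inl ha.symm)))
    rcases hH y x b c hy.symm hb hc hxb' hxc' hbc with h | h | h
    · exact .inl (heavy b hab hxb h)
    · exact .inr (.inl (heavy c hac hxc h))
    · exact .inr (.inr (h.mono (le_localCompletion H x)))
  intro y a b c ha hb hc hab hac hbc
  by_cases ha' : H.Adj y a
  swap
  · have h := ha.resolve_left ha'
    exact main y a b c hb hc hab hac hbc h.2.1 h.2.2
  by_cases hb' : H.Adj y b
  swap
  · have h := hb.resolve_left hb'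
    rcases main y b a c ha hc hab.symm hbc hac h.2.1 h.2.2 with h | h | h
    · exact .inl h.symm
    · exact .inr (.inr h)
    · exact .inr (.inl h)
  by_cases hc' : H.Adj y c
  swap
  · have h := hc.resolve_left hc'
    rcases main y c a b ha hb hac.symm hbc.symm hab h.2.1 h.2.2 with h | h | h
    · exact .inr (.inl h.symm)
    · exact .inr (.inr h.symm)
    · exact .inl h
  rcases hH y a b c ha' hb' hc' hab hac hbc with h | h | h
  · exact .inl (h.mono (le_localCompletion H x))
  · exact .inr (.inl (h.mono (le_localCompletion H x)))
  · exact .inr (.inr (h.mono (le_localCompletion H x)))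

lemma WalkList.trans {G : SimpleGraph V} {a b c : V} {l m : List V} (h : WalkList G a l b)
    (h' : WalkList G b m c) : ∃ k, WalkList G a k c ∧ ∀ v ∈ k, v ∈ l ∨ v ∈ m := by
  obtain ⟨t, rfl⟩ := h'.exists_cons
  rcases eq_or_ne t [] with rfl | ht
  · obtain ⟨-, rfl⟩ := h'.eq_of_singleton
    exact ⟨l, h, fun v hv => .inl hv⟩
  · obtain ⟨p, q, h1, h2, h3⟩ := WalkList.split (l := [b]) (m := t) h' (by simp) ht
    obtain rfl := h1.eq_of_singleton.2
    exact ⟨l ++ t, h.append h2 h3, fun v hv => by simp at hv ⊢; tauto⟩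

/-- The ends of each edge of `H` are joined by a walk of `G` through common neighbours in `H`
that are simplicial in `H`. -/
def SimpliciallyLinked (G H : SimpleGraph V) : Prop :=
  ∀ p q, H.Adj p q → ∃ l, WalkList G p l q ∧
    ∀ r ∈ l, r = p ∨ r = q ∨ (Simplicial H r ∧ H.Adj r p ∧ H.Adj r q)

lemma Simplicial.localCompletion {H : SimpleGraph V} {x r : V} (hr : Simplicial H r) :
    Simplicial (localCompletion H x) r := by
  by_cases hrx : H.Adj r x
  · have key : ∀ s, (_root_.localCompletion H x).Adj r s → s = x ∨ H.Adj x s := by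
      rintro s (h | h)
      · by_cases e : s = x
        · exact .inl e
        · exact .inr (hr _ _ h hrx e).symm
      · exact .inr h.2.2
    intro s t hs ht hst
    rcases key s hs with rfl | h1
    · rcases key t ht with rfl | h2
      · exact (hst rfl).elim
      · exact .inl h2
    · rcases key t ht with rfl | h2
      · exact .inl h1.symm
      · exact .inr ⟨hst, h1, h2⟩
  · intro s t hs ht hst
    have key : ∀ s, (_root_.localCompletion H x).Adj r s → H.Adj r s := by
      rintro s (h | h)
      · exact h
      · exact (hrx h.2.1.symm).elim
    exact .inl (hr s t (key s hs) (key t ht) hst)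

lemma simplicial_localCompletion (H : SimpleGraph V) (x : V) :
    Simplicial (localCompletion H x) x := by
  have key : ∀ s, (localCompletion H x).Adj x s → H.Adj x s := by
    rintro s (h | h)
    · exact h
    · exact h.2.2
  exact fun s t hs ht hst => .inr ⟨hst, key s hs, key t ht⟩

lemma SimpliciallyLinked.localCompletion {G H : SimpleGraph V} (h : SimpliciallyLinked G H)
    (x : V) : SimpliciallyLinked G (localCompletion H x) := by
  intro p q hpq
  by_cases hpq' : H.Adj p q
  · obtain ⟨l, hl, hr⟩ := h p q hpq'
    refine ⟨l, hl, fun r hrl => ?_⟩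
    rcases hr r hrl with h | h | h
    · exact .inl h
    · exact .inr (.inl h)
    · exact .inr (.inr ⟨h.1.localCompletion, .inl h.2.1, .inl h.2.2⟩)
  · obtain ⟨hne, hxp, hxq⟩ := hpq.resolve_left hpq'
    obtain ⟨l, hl, hrl⟩ := h p x hxp.symm
    obtain ⟨m, hm, hrm⟩ := h x q hxq
    obtain ⟨k, hk, hkm⟩ := hl.trans hm
    have hx : Simplicial (_root_.localCompletion H x) x ∧ (_root_.localCompletion H x).Adj x p ∧
      (_root_.localCompletion H x).Adj x q :=
        ⟨simplicial_localCompletion H x, .inl hxp, .inl hxq⟩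
    refine ⟨k, hk, fun r hrk => ?_⟩
    by_cases h1 : r = p
    · exact .inl h1
    by_cases h2 : r = q
    · exact .inr (.inl h2)
    refine .inr (.inr ?_)
    rcases hkm r hrk with h3 | h3
    · rcases hrl r h3 with h | rfl | h
      · contradiction
      · exact hx
      · exact ⟨h.1.localCompletion, .inl h.2.1, .inr ⟨h2, h.2.2.symm, hxq⟩⟩
    · rcases hrm r h3 with rfl | h | h
      · exact hx
      · contradiction
      · exact ⟨h.1.localCompletion, .inr ⟨h1, h.2.1.symm, hxp⟩, .inl h.2.2⟩

/-- The non-hamiltonian supergraphs of `G` considered by the closure argument. -/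
structure IsPartialClosure [Fintype V] (G H : SimpleGraph V) : Prop where
  le : G ≤ H
  not_ham : ¬ HasHamCycle H
  claw : ClawHeavy H
  linked : SimpliciallyLinked G H

lemma IsPartialClosure.self [Fintype V] {G : SimpleGraph V} (h : ¬ HasHamCycle G)
    (hc : ClawHeavy G) : IsPartialClosure G G where
  le := le_rfl
  not_ham := h
  claw := hc
  linked p q hpq := ⟨[p] ++ [q], (WalkList.single G p).append hpq (.single G q),
    fun r hr => by simp at hr; tauto⟩

section Maximal

variable [Fintype V] {G H : SimpleGraph V} {x y z w : V}

lemma clique_of_not_ham (hH : Maximal (IsPartialClosure G) H)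
    (hx : ¬ HasHamCycle (localCompletion H x)) : Simplicial H x := by
  have h : IsPartialClosure G (localCompletion H x) :=
    ⟨hH.prop.le.trans (le_localCompletion H x), hx, hH.prop.claw.localCompletion x,
      hH.prop.linked.localCompletion x⟩
  exact fun s t hs ht hst => hH.le_of_ge h (le_localCompletion H x) (.inr ⟨hst, hs, ht⟩)

/-- The two maximal non-hamiltonian graphs used in the exchange argument. -/
structure ExchangePair (H M B : SimpleGraph V) (x : V) : Prop where
  le_left : H ≤ M
  left_le : M ≤ localCompletion H x
  le : M ≤ B
  not_ham : ¬ HasHamCycle B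
  of_oAdj : ∀ p q, OAdj H p q → B.Adj p q
  ham_of_not_adj : ∀ p q, H.Adj x p → H.Adj x q → p ≠ q → ¬ M.Adj p q →
    HasHamCycle (M ⊔ edge p q)

lemma exists_exchangePair (hV : 3 ≤ Fintype.card V) (hH : ¬ HasHamCycle H) (x : V) :
    ∃ M B, ExchangePair H M B x := by
  obtain ⟨M, hHM, hM⟩ := Finite.exists_le_maximal
    (p := fun M : SimpleGraph V => H ≤ M ∧ M ≤ localCompletion H x ∧ ¬ HasHamCycle M)
    ⟨le_rfl, le_localCompletion H x, hH⟩
  obtain ⟨B, hMB, hB⟩ := Finite.exists_le_maximal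
    (p := fun B : SimpleGraph V => ¬ HasHamCycle B) hM.prop.2.2
  refine ⟨M, B, hHM, hM.prop.2.1, hMB, hB.prop, ?_, ?_⟩
  · rintro p q (h | h)
    · exact hMB (hHM h)
    · by_contra hpq
      have : HasHamCycle (B ⊔ edge p q) := by
        by_contra hn
        exact hpq (hB.le_of_ge hn le_sup_left (by simp [edge_adj, h.1]))
      have h1 := dg_mono (hHM.trans hMB) p
      have h2 := dg_mono (hHM.trans hMB) q
      exact hB.prop (hasHamCycle_of_sup_edge hV (by omega) this)
  · intro p q hp hq hpq hM'
    by_contra hn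
    refine hM' (hM.le_of_ge ⟨hHM.trans le_sup_left, sup_le hM.prop.2.1 ?_, hn⟩ le_sup_left
      (by simp [edge_adj, hpq]))
    intro a b hab
    rw [edge_adj] at hab
    obtain ⟨⟨rfl, rfl⟩ | ⟨rfl, rfl⟩, h⟩ := hab
    · exact .inr ⟨h, hp, hq⟩
    · exact .inr ⟨h, hq, hp⟩

namespace ExchangePair

variable {M B : SimpleGraph V}

lemma adj_of_oAdj (h : ExchangePair H M B x) (hy : H.Adj x y) (hz : H.Adj x z)
    (hyz : OAdj H y z) : M.Adj y z := by
  by_contra hn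
  obtain ⟨l, ⟨hl, a, b, hw, hab⟩, hs⟩ := h.ham_of_not_adj y z hy hz hyz.ne hn
  have hle : M ⊔ edge y z ≤ B := by
    refine sup_le h.le fun a b hab => ?_
    rw [edge_adj] at hab
    obtain ⟨⟨rfl, rfl⟩ | ⟨rfl, rfl⟩, -⟩ := hab
    · exact h.of_oAdj _ _ hyz
    · exact (h.of_oAdj _ _ hyz).symm
  exact h.not_ham ⟨l, ⟨hl, a, b, hw.mono hle, hle hab⟩, hs⟩

lemma exchange (h : ExchangePair H M B x) (hV : 3 ≤ Fintype.card V) (hc : ClawHeavy H)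
    (hy : H.Adj x y) (hw : H.Adj x w) (hyw : y ≠ w)
    (hzx : B.Adj z x) (hzy : B.Adj z y) (hzw : B.Adj z w)
    (hcase : H.Adj x z ∨ (¬ H.Adj x z ∧ H.Adj z y ∧ H.Adj z w)) : M.Adj y w := by
  by_contra hn
  have hM : ¬ HasHamCycle M := fun ⟨l, ⟨hl, a, b, hw, hab⟩, hs⟩ =>
    h.not_ham ⟨l, ⟨hl, a, b, hw.mono h.le, h.le hab⟩, hs⟩
  obtain ⟨l, hl, hln, hs⟩ := exists_hamPath_of_sup_edge hV hM (h.ham_of_not_adj y w hy hw hyw hn)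
  refine _root_.exchange h.le_left h.le ?_ h.not_ham ?_ hl hln hs hy hw hzx hzy hzw hcase
  · intro a b hab
    rcases h.left_le hab with h | h
    · exact .inl h
    · exact .inr h.2
  · intro y a b c ha hb hc' hab hac hbc
    have := hc y a b c ha hb hc' hab hac hbc
    have := h.of_oAdj
    grind

lemma trans (h : ExchangePair H M B x) (hV : 3 ≤ Fintype.card V) (hc : ClawHeavy H)
    (hy : H.Adj x y) (hz : H.Adj x z) (hw : H.Adj x w) (hyw : y ≠ w)
    (hyz : M.Adj y z) (hzw : M.Adj z w) : M.Adj y w :=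
  h.exchange hV hc hy hw hyw (h.le (h.le_left hz.symm)) (h.le hyz.symm) (h.le hzw) (.inl hz)

/-- If `M` is complete on the neighbourhood of `x`, so is `H`. -/
lemma simplicial (h : ExchangePair H M B x) (hH : Maximal (IsPartialClosure G) H)
    (hM : ∀ s t, H.Adj x s → H.Adj x t → s ≠ t → M.Adj s t) : Simplicial H x := by
  refine clique_of_not_ham hH ?_
  rintro ⟨l, ⟨hl, a, b, hw, hab⟩, hs⟩
  have hle : localCompletion H x ≤ B := by
    rintro a b (h' | h')
    · exact h.le (h.le_left h')
    · exact h.le (hM a b h'.2.1 h'.2.2 h'.1)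
  exact h.not_ham ⟨l, ⟨hl, a, b, hw.mono hle, hle hab⟩, hs⟩

lemma not_adj (h : ExchangePair H M B x) (hV : 3 ≤ Fintype.card V)
    (hH : Maximal (IsPartialClosure G) H)
    (hy : H.Adj x y) (hw : H.Adj x w) (hyw : y ≠ w) (ho : ¬ OAdj H y w) : ¬ M.Adj y w := by
  intro hM
  refine ho (.inl (h.simplicial hH ?_ y w hy hw hyw))
  have key : ∀ t, H.Adj x t → t ≠ y → M.Adj t y := by
    intro t ht hty
    rcases eq_or_ne t w with rfl | htw
    · exact hM.symm
    rcases hH.prop.claw x t y w ht hy hw hty htw hyw with h' | h' | h'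
    · exact h.adj_of_oAdj ht hy h'
    · exact h.trans hV hH.prop.claw ht hw hy hty (h.adj_of_oAdj ht hw h') hM.symm
    · exact (ho h').elim
  intro s t hs ht hst
  rcases eq_or_ne s y with rfl | hsy
  · exact (key t ht hst.symm).symm
  rcases eq_or_ne t y with rfl | hty
  · exact key s hs hst
  exact h.trans hV hH.prop.claw hs hy ht hst (key s hs hsy) (key t ht hty).symm

end ExchangePair

lemma oAdj_trans (hV : 3 ≤ Fintype.card V) (hH : Maximal (IsPartialClosure G) H)
    (hy : H.Adj x y) (hz : H.Adj x z) (hw : H.Adj x w) (hyw : y ≠ w)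
    (hyz : OAdj H y z) (hzw : OAdj H z w) : OAdj H y w := by
  by_contra ho
  obtain ⟨M, B, h⟩ := exists_exchangePair hV hH.prop.not_ham x
  exact h.not_adj hV hH hy hw hyw ho
    (h.trans hV hH.prop.claw hy hz hw hyw (h.adj_of_oAdj hy hz hyz) (h.adj_of_oAdj hz hw hzw))

lemma simplicial_of_oAdj (hV : 3 ≤ Fintype.card V) (hH : Maximal (IsPartialClosure G) H)
    (h : ∀ s t, H.Adj x s → H.Adj x t → s ≠ t → OAdj H s t) : Simplicial H x := by
  obtain ⟨M, B, hMB⟩ := exists_exchangePair hV hH.prop.not_ham x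
  exact hMB.simplicial hH fun s t hs ht hst => hMB.adj_of_oAdj hs ht (h s t hs ht hst)

lemma oAdj_of_common (hV : 3 ≤ Fintype.card V) (hH : Maximal (IsPartialClosure G) H)
    (hxz : OAdj H x z) (hxz' : ¬ H.Adj x z) (hy : H.Adj x y) (hzy : H.Adj z y)
    (hw : H.Adj x w) (hzw : H.Adj z w) (hyw : y ≠ w) : OAdj H y w := by
  by_contra ho
  obtain ⟨M, B, h⟩ := exists_exchangePair hV hH.prop.not_ham x
  exact h.not_adj hV hH hy hw hyw ho (h.exchange hV hH.prop.claw hy hw hyw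
    (h.of_oAdj _ _ hxz).symm (h.le (h.le_left hzy)) (h.le (h.le_left hzw)) (.inr ⟨hxz', hzy, hzw⟩))

/-- A maximal partial closure has no nonadjacent heavy pair. -/
lemma adj_of_oAdj (hV : 3 ≤ Fintype.card V) (hH : Maximal (IsPartialClosure G) H) {u v : V}
    (huv : OAdj H u v) : H.Adj u v := by
  by_contra hn
  have hheavy := (huv.resolve_left hn).2
  have hex : ∀ c, ∃ d, H.Adj u c → H.Adj v c → H.Adj c d ∧ u ≠ d ∧ ¬ OAdj H u d := by
    intro c
    by_cases hc : H.Adj u c ∧ H.Adj v c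
    swap
    · exact ⟨c, by tauto⟩
    by_contra! hd
    refine hn ((simplicial_of_oAdj (x := c) hV hH ?_) u v hc.1.symm hc.2.symm huv.ne)
    have hd' : ∀ d, H.Adj c d → u ≠ d → OAdj H u d := fun d h1 h2 => (hd d).2.2 h1 h2
    intro s t hs ht hst
    rcases eq_or_ne u s with rfl | h1
    · exact hd' t ht hst
    rcases eq_or_ne u t with rfl | h2
    · exact (hd' s hs h1).symm
    exact oAdj_trans hV hH hs hc.1.symm ht hst (hd' s hs h1).symm (hd' t ht h2)
  choose f hf using hex
  have := dg_add_dg_lt huv.ne hn f ?_ ?_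
  · omega
  · intro c hu hv
    obtain ⟨h1, h2, h3⟩ := hf c hu hv
    refine ⟨h2.symm, fun e => h3 (e ▸ huv), fun h => h3 (.inl h), fun h => h3 ?_⟩
    exact oAdj_trans hV hH hu.symm hv.symm h1 h2 huv (.inl h)
  · intro c d huc hvc hud hvd e
    obtain ⟨h1, h2, h3⟩ := hf c huc hvc
    obtain ⟨k1, k2, k3⟩ := hf d hud hvd
    rw [← e] at k1
    by_contra hcd
    have ho := oAdj_of_common hV hH huv hn huc hvc hud hvd hcd
    by_cases hadj : H.Adj c d
    · exact h3 (oAdj_trans hV hH huc.symm hadj h1 h2 (.inl hud) (.inl k1))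
    · exact h3 (oAdj_of_common hV hH ho hadj huc.symm hud.symm h1 k1 h2)

end Maximal

/-- The closure of a non-hamiltonian claw-o-heavy graph. -/
structure IsClosureOf [Fintype V] (G H : SimpleGraph V) : Prop where
  le : G ≤ H
  not_ham : ¬ HasHamCycle H
  linked : SimpliciallyLinked G H
  claw : ClawIn H H
  diamond : ∀ x y z w, H.Adj x y → H.Adj x z → H.Adj x w → y ≠ w → H.Adj y z → H.Adj z w →
    H.Adj y w
  heavy : ∀ u v, u ≠ v → Fintype.card V ≤ dg G u + dg G v → H.Adj u v

lemma exists_isClosureOf [Fintype V] {G : SimpleGraph V} (hV : 3 ≤ Fintype.card V)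
    (hG : ¬ HasHamCycle G) (hc : ClawHeavy G) : ∃ H, IsClosureOf G H := by
  obtain ⟨H, -, hH⟩ := Finite.exists_le_maximal (IsPartialClosure.self hG hc)
  have hadj : ∀ {p q}, OAdj H p q → H.Adj p q := adj_of_oAdj hV hH
  refine ⟨H, hH.prop.le, hH.prop.not_ham, hH.prop.linked, ?_, ?_, ?_⟩
  · intro y a b c h1 h2 h3 h4 h5 h6
    have := hH.prop.claw y a b c h1 h2 h3 h4 h5 h6
    grind
  · intro x y z w hy hz hw hyw hyz hzw
    exact hadj (oAdj_trans hV hH hy hz hw hyw (.inl hyz) (.inl hzw))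
  · intro u v huv h
    have := dg_mono hH.prop.le u
    have := dg_mono hH.prop.le v
    exact hadj (.inr ⟨huv, by omega⟩)

/-- A cycle `u α v β` of maximum length together with a path `R` outside it joining `u` to `v`,
where no vertex of `α` is adjacent to `R` and `R` cannot be shortened. -/
structure IsEar (H : SimpleGraph V) (u v a a' b b' h s : V) (α β R : List V) : Prop where
  walk_left : WalkList H a α a'
  walk_right : WalkList H b β b'
  walk_ear : WalkList H h R s
  adj_ua : H.Adj u a
  adj_av : H.Adj a' v
  adj_vb : H.Adj v b
  adj_bu : H.Adj b' u
  adj_uh : H.Adj u h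
  adj_sv : H.Adj s v
  nodup : (α ++ β ++ R ++ [u, v]).Nodup
  max : ∀ m, IsCycleList H m → m.length ≤ α.length + β.length + 2
  far : ∀ t ∈ α, ∀ r ∈ R, ¬ H.Adj t r
  short : ∀ R' h' s', WalkList H h' R' s' → R'.Sublist R → H.Adj u h' → H.Adj s' v →
    R.length ≤ R'.length

/-- `a` and `b` are joined by a path avoiding their common closed neighbourhood. -/
def OutsideLinked (H : SimpleGraph V) (a b : V) : Prop :=
  ∃ σ c d, WalkList H c σ d ∧ H.Adj a c ∧ H.Adj d b ∧
    ∀ x ∈ σ, ¬ ((x = a ∨ H.Adj x a) ∧ (x = b ∨ H.Adj x b))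

lemma OutsideLinked.symm {H : SimpleGraph V} {a b : V} (h : OutsideLinked H a b) :
    OutsideLinked H b a := by
  obtain ⟨σ, c, d, h1, h2, h3, h4⟩ := h
  exact ⟨σ.reverse, d, c, h1.reverse, h3.symm, h2.symm, fun x hx => by
    have := h4 x (by simpa using hx); tauto⟩

lemma isInducedP6_of {H : SimpleGraph V} {a b c d e f : V} (h01 : H.Adj a b) (h12 : H.Adj b c)
    (h23 : H.Adj c d) (h34 : H.Adj d e) (h45 : H.Adj e f)
    (h02 : ¬ H.Adj a c) (h03 : ¬ H.Adj a d) (h04 : ¬ H.Adj a e) (h05 : ¬ H.Adj a f)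
    (h13 : ¬ H.Adj b d) (h14 : ¬ H.Adj b e) (h15 : ¬ H.Adj b f)
    (h24 : ¬ H.Adj c e) (h25 : ¬ H.Adj c f) (h35 : ¬ H.Adj d f) :
    IsInducedP6 H ![a, b, c, d, e, f] := by
  have key : ∀ i j : Fin 6, H.Adj (![a, b, c, d, e, f] i) (![a, b, c, d, e, f] j) ↔
      (i.val + 1 = j.val ∨ j.val + 1 = i.val) := by
    intro i j
    fin_cases i <;> fin_cases j <;> simp [*, H.adj_comm]
  refine ⟨fun i j hij => ?_, key⟩
  have h : ∀ k : Fin 6, (i.val + 1 = k.val ∨ k.val + 1 = i.val) ↔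
      (j.val + 1 = k.val ∨ k.val + 1 = j.val) := fun k => by
    rw [← key, ← key, hij]
  clear hij
  revert i j
  decide

lemma exists_last {P : V → Prop} {l : List V} (h : ∃ x ∈ l, P x) :
    ∃ l₁ x l₂, l = l₁ ++ [x] ++ l₂ ∧ P x ∧ ∀ y ∈ l₂, ¬ P y := by
  induction l with
  | nil => simp at h
  | cons a l ih =>
    by_cases h' : ∃ x ∈ l, P x
    · obtain ⟨l₁, x, l₂, rfl, h1, h2⟩ := ih h'
      exact ⟨a :: l₁, x, l₂, by simp, h1, h2⟩
    · push Not at h'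
      have : P a := by
        obtain ⟨x, hx, hP⟩ := h
        rcases List.mem_cons.1 hx with rfl | hx
        · exact hP
        · exact (h' x hx hP).elim
      exact ⟨[], a, l, by simp, this, h'⟩

lemma exists_first {P : V → Prop} {l : List V} (h : ∃ x ∈ l, P x) :
    ∃ l₁ x l₂, l = l₁ ++ [x] ++ l₂ ∧ P x ∧ ∀ y ∈ l₁, ¬ P y := by
  obtain ⟨l₁, x, l₂, h1, h2, h3⟩ := exists_last (P := P) (l := l.reverse) (by simpa using h)
  refine ⟨l₂.reverse, x, l₁.reverse, ?_, h2, by simpa using h3⟩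
  have := congrArg List.reverse h1
  simpa using this

/-- Split a walk after the last vertex satisfying `P`. -/
lemma WalkList.split_last {H : SimpleGraph V} {P : V → Prop} {l : List V} {a b : V}
    (h : WalkList H a l b) (hP : ∃ x ∈ l, P x) (hb : ¬ P b) :
    ∃ l₁ l₂ t y, l = l₁ ++ l₂ ∧ WalkList H a l₁ t ∧ H.Adj t y ∧ WalkList H y l₂ b ∧ P t ∧
      ∀ z ∈ l₂, ¬ P z := by
  obtain ⟨l₁, x, l₂, rfl, h1, h2⟩ := exists_last hP
  have hne : l₂ ≠ [] := by
    rintro rfl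
    have := h.2.2
    simp at this
    exact hb (this ▸ h1)
  obtain ⟨t, y, h3, h4, h5⟩ := h.split (by simp) hne
  obtain rfl : x = t := by simpa using h3.2.2
  exact ⟨l₁ ++ [x], l₂, x, y, rfl, h3, h4, h5, h1, h2⟩

namespace IsEar

variable {H : SimpleGraph V} {u v a a' b b' h s : V} {α β R : List V}

lemma swap (e : IsEar H u v a a' b b' h s α β R) :
    IsEar H v u a' a b' b s h α.reverse β.reverse R.reverse where
  walk_left := e.walk_left.reverse
  walk_right := e.walk_right.reverse
  walk_ear := e.walk_ear.reverse
  adj_ua := e.adj_av.symm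
  adj_av := e.adj_ua.symm
  adj_vb := e.adj_bu.symm
  adj_bu := e.adj_vb.symm
  adj_uh := e.adj_sv.symm
  adj_sv := e.adj_uh.symm
  nodup := by
    classical
    refine (List.Perm.nodup_iff ?_).1 e.nodup
    rw [List.perm_iff_count]; intro
    simp only [List.count_append, List.count_reverse, List.count_cons, List.count_nil]; omega
  max m hm := by simpa using e.max m hm
  far t ht r hr := e.far t (by simpa using ht) r (by simpa using hr)
  short R' h' s' hw hs h1 h2 := by
    have := e.short R'.reverse s' h' hw.reverse (by simpa using hs.reverse) h2.symm h1.symm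
    simpa using this

lemma longer (e : IsEar H u v a a' b b' h s α β R) {m R' : List V} {c d : V}
    (hm : WalkList H c m d) (hdc : H.Adj d c) (hR : R'.Sublist R) (hR' : R' ≠ [])
    (hp : m.Perm (α ++ β ++ R' ++ [u, v])) : False := by
  have hn : (α ++ β ++ R' ++ [u, v]).Nodup :=
    (((hR.append_left (α ++ β)).append_right [u, v])).nodup e.nodup
  have h1 := e.max m ⟨hp.nodup_iff.2 hn, c, d, hm, hdc⟩
  have h2 := hp.length_eq
  have h3 : 0 < R'.length := List.length_pos_of_ne_nil hR'
  simp at h2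
  omega

lemma longer_ear (e : IsEar H u v a a' b b' h s α β R) {m : List V} {c d : V}
    (hm : WalkList H c m d) (hdc : H.Adj d c)
    (hp : m.Perm (α ++ β ++ R ++ [u, v])) : False :=
  e.longer hm hdc (.refl R) e.walk_ear.ne_nil hp

lemma disjoint (e : IsEar H u v a a' b b' h s α β R) :
    (∀ x ∈ α, x ∉ β ∧ x ∉ R ∧ x ≠ u ∧ x ≠ v) ∧ (∀ x ∈ β, x ∉ R ∧ x ≠ u ∧ x ≠ v) ∧
      (∀ x ∈ R, x ≠ u ∧ x ≠ v) ∧ u ≠ v := by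
  have := e.nodup
  simp only [List.nodup_append, List.mem_append] at this
  grind

lemma not_adj_hb (e : IsEar H u v a a' b b' h s α β R) : ¬ H.Adj b' h := fun hc => by
  classical
  exact e.longer (R' := [h])
    (((((WalkList.single H u).append e.adj_ua e.walk_left).append e.adj_av
      (.single H v)).append e.adj_vb e.walk_right).append hc (.single H h)) e.adj_uh.symm
    (List.singleton_sublist.2 e.walk_ear.head_mem) (by simp)
    (by rw [List.perm_iff_count]; intro
        simp only [List.count_append, List.count_cons, List.count_nil]; omega)

lemma adj_ab (e : IsEar H u v a a' b b' h s α β R) (hc : ClawIn H H) : H.Adj a b' := by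
  have hd := e.disjoint
  have h1 := e.walk_left.head_mem
  have h2 := e.walk_right.last_mem
  have h3 := e.walk_ear.head_mem
  rcases hc u h a b' e.adj_uh e.adj_ua e.adj_bu.symm (by grind) (by grind) (by grind)
    with h' | h' | h'
  · exact (e.far a h1 h h3 h'.symm).elim
  · exact (e.not_adj_hb h'.symm).elim
  · exact h'

lemma not_adj_ua (e : IsEar H u v a a' b b' h s α β R) (hc : ClawIn H H) : ¬ H.Adj u a' :=
  fun h' => by
  classical
  exact e.longer_ear
    (((((WalkList.single H u).append e.adj_uh e.walk_ear).append e.adj_sv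
      (.single H v)).append e.adj_vb e.walk_right).append (e.adj_ab hc).symm e.walk_left) h'.symm
    (by rw [List.perm_iff_count]; intro
        simp only [List.count_append, List.count_cons, List.count_nil]; omega)

lemma not_adj_vb (e : IsEar H u v a a' b b' h s α β R) (hc : ClawIn H H) : ¬ H.Adj v b' :=
  fun h' => by
  classical
  exact e.longer_ear
    (((((WalkList.single H v).append e.adj_sv.symm e.walk_ear.reverse).append e.adj_uh.symm
      (.single H u)).append e.adj_ua e.walk_left).append (e.swap.adj_ab hc) e.walk_right) h'.symm
    (by rw [List.perm_iff_count]; intro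
        simp only [List.count_append, List.count_cons, List.count_nil, List.count_reverse]; omega)

lemma exists_isInducedP6 (e : IsEar H u v a a' b b' h s α β R) (hc : ClawIn H H)
    (hd : ∀ x y z w, H.Adj x y → H.Adj x z → H.Adj x w → y ≠ w → H.Adj y z → H.Adj z w →
      H.Adj y w) :
    ∃ p : Fin 6 → V, IsInducedP6 H p ∧ OutsideLinked H (p 1) (p 2) ∧
      OutsideLinked H (p 2) (p 3) ∧ OutsideLinked H (p 3) (p 4) := by
  classical
  obtain ⟨dα, dβ, dR, duv⟩ := e.disjoint
  have ma := e.walk_left.head_mem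
  have ma' := e.walk_left.last_mem
  have mb := e.walk_right.head_mem
  have mb' := e.walk_right.last_mem
  have mh := e.walk_ear.head_mem
  have ms := e.walk_ear.last_mem
  have hab := e.adj_ab hc
  have hab' := e.swap.adj_ab hc
  have nua := e.not_adj_ua hc
  have nva := e.swap.not_adj_ua hc
  have nvb := e.not_adj_vb hc
  have nub := e.swap.not_adj_vb hc
  have nhb := e.not_adj_hb
  have nsb := e.swap.not_adj_hb
  obtain ⟨A₁, A₂, t₁, y₁, rfl, wA₁, ht₁y₁, wA₂, hut₁, hA₂⟩ :=
    e.walk_left.split_last (P := H.Adj u) ⟨a, ma, e.adj_ua⟩ nua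
  obtain ⟨B₁, B₂, t₂, y₂, rfl, wB₁, ht₂y₂, wB₂, ⟨hvt₂, nst₂⟩, hB₂⟩ :=
    e.walk_right.split_last (P := fun t => H.Adj v t ∧ ¬ H.Adj t s) ⟨b, mb, e.adj_vb, nsb⟩
      (fun h' => nvb h'.1)
  have mt₁ : t₁ ∈ A₁ ++ A₂ := by simp [wA₁.last_mem]
  have my₁ : y₁ ∈ A₁ ++ A₂ := by simp [wA₂.head_mem]
  have mt₂ : t₂ ∈ B₁ ++ B₂ := by simp [wB₁.last_mem]
  have my₂ : y₂ ∈ B₁ ++ B₂ := by simp [wB₂.head_mem]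
  have nuy₁ := hA₂ y₁ wA₂.head_mem
  have hB₂K : ∀ x ∈ B₂, H.Adj v x → ¬ H.Adj x t₂ := fun x hx hvx hxt => by
    have hxs : H.Adj x s := by
      by_contra h'; exact hB₂ x hx ⟨hvx, h'⟩
    exact nst₂ (hd v t₂ x s hvt₂ hvx e.adj_sv.symm (by grind) hxt.symm hxs)
  have nvy₂ : ¬ H.Adj v y₂ := fun h' => hB₂K y₂ wB₂.head_mem h' ht₂y₂.symm
  have nvy₁ : ¬ H.Adj v y₁ := fun h' => e.longer_ear
    ((((((WalkList.single H u).append hut₁ wA₁.reverse).append hab e.walk_right.reverse).append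
      hab'.symm wA₂.reverse).append h'.symm (.single H v)).append e.adj_sv.symm
      e.walk_ear.reverse) e.adj_uh.symm
    (by rw [List.perm_iff_count]; intro
        simp only [List.count_append, List.count_cons, List.count_nil, List.count_reverse]; omega)
  have nuy₂ : ¬ H.Adj u y₂ := fun h' => e.longer_ear
    ((((((WalkList.single H v).append hvt₂ wB₁.reverse).append hab'.symm
      e.walk_left.reverse).append hab wB₂.reverse).append h'.symm (.single H u)).append e.adj_uh
      e.walk_ear) e.adj_sv
    (by rw [List.perm_iff_count]; intro
        simp only [List.count_append, List.count_cons, List.count_nil, List.count_reverse]; omega)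
  have ny₁y₂ : ¬ H.Adj y₁ y₂ := fun h' => e.longer_ear
    (((((((WalkList.single H u).append hut₁ wA₁.reverse).append hab wB₂.reverse).append
      h'.symm wA₂).append hab' wB₁).append hvt₂.symm (.single H v)).append e.adj_sv.symm
      e.walk_ear.reverse) e.adj_uh.symm
    (by rw [List.perm_iff_count]; intro
        simp only [List.count_append, List.count_cons, List.count_nil, List.count_reverse]; omega)
  have hvh : H.Adj u v → H.Adj v h := fun huv => by
    rcases hc u v h a huv e.adj_uh e.adj_ua (by grind) (by grind) (by grind) with h' | h' | h'
    · exact h'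
    · exact (nva h').elim
    · exact (e.far a ma h mh h'.symm).elim
  have nt₁v : ¬ H.Adj t₁ v := fun h' => by
    by_cases huv : H.Adj u v
    · have hne : t₁ ≠ a := by rintro rfl; exact nva h'.symm
      have hta : H.Adj t₁ a := by
        rcases hc u t₁ a h hut₁ e.adj_ua e.adj_uh hne (by grind) (by grind) with h' | h' | h'
        · exact h'
        · exact (e.far _ mt₁ h mh h').elim
        · exact (e.far _ ma h mh h').elim
      exact nva (hd u v t₁ a huv hut₁ e.adj_ua (by grind) h'.symm hta)
    · rcases hc t₁ u v y₁ hut₁.symm h' ht₁y₁ duv (by grind) (by grind) with h' | h' | h' <;>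
        contradiction
  have nt₂u : ¬ H.Adj t₂ u := fun h' => by
    by_cases huv : H.Adj u v
    · have hne : t₂ ≠ b := by rintro rfl; exact nub h'.symm
      have htb : H.Adj t₂ b := by
        rcases hc v t₂ b s hvt₂ e.adj_vb e.adj_sv.symm hne (by grind) (by grind) with h' | h' | h'
        · exact h'
        · exact (nst₂ h').elim
        · exact (nsb h').elim
      exact nub (hd v u t₂ b huv.symm hvt₂ e.adj_vb (by grind) h'.symm htb)
    · rcases hc t₂ u v y₂ h' hvt₂.symm ht₂y₂ duv (by grind) (by grind) with h' | h' | h' <;>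
        contradiction
  have ny₁t₂ : ¬ H.Adj y₁ t₂ := fun h' => by
    rcases hc t₂ v y₁ y₂ hvt₂.symm h'.symm ht₂y₂ (by grind) (by grind) (by grind)
      with h' | h' | h' <;> contradiction
  have nt₁y₂ : ¬ H.Adj t₁ y₂ := fun h' => by
    rcases hc t₁ u y₁ y₂ hut₁.symm ht₁y₁ h' (by grind) (by grind) (by grind)
      with h' | h' | h' <;> contradiction
  have nt₁t₂ : ¬ H.Adj t₁ t₂ := fun h' => by
    rcases hc t₁ u y₁ t₂ hut₁.symm ht₁y₁ h' (by grind) (by grind) (by grind)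
      with h' | h' | h'
    · contradiction
    · exact nt₂u h'.symm
    · contradiction
  have hA₂u : ∀ x ∈ A₂, ¬ (x = u ∨ H.Adj x u) := by
    rintro x hx (rfl | h')
    · exact (dα x (by simp [hx])).2.2.1 rfl
    · exact hA₂ x hx h'.symm
  have hαR : ∀ x ∈ A₁ ++ A₂, ∀ r ∈ R, ¬ (x = r ∨ H.Adj x r) := by
    rintro x hx r hr (rfl | h')
    · exact (dα x hx).2.1 hr
    · exact e.far x hx r hr h'
  by_cases huv : H.Adj u v
  · refine ⟨![y₁, t₁, u, v, t₂, y₂], isInducedP6_of ht₁y₁.symm hut₁.symm huv hvt₂ ht₂y₂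
      (fun h' => nuy₁ h'.symm) (fun h' => nvy₁ h'.symm) ny₁t₂ ny₁y₂ nt₁v nt₁t₂ nt₁y₂
      (fun h' => nt₂u h'.symm) nuy₂ nvy₂, ?_, ?_, ?_⟩
    · refine ⟨A₂ ++ [v], y₁, v, wA₂.append e.adj_av (.single H v), ht₁y₁, huv.symm, ?_⟩
      intro x hx
      rcases List.mem_append.1 hx with hx | hx
      · exact fun h' => hA₂u x hx h'.2
      · obtain rfl := List.mem_singleton.1 hx
        rintro ⟨h' | h', -⟩
        · exact (dα _ mt₁).2.2.2 h'.symm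
        · exact nt₁v h'.symm
    · refine ⟨A₁ ++ A₂, a, a', e.walk_left, e.adj_ua, e.adj_av, ?_⟩
      rintro x hx ⟨h1 | h1, h2 | h2⟩
      · exact (dα x hx).2.2.1 h1
      · exact (dα x hx).2.2.1 h1
      · exact (dα x hx).2.2.2 h2
      · exact e.far x hx h mh (hd u x v h h1.symm huv e.adj_uh (by grind) h2 (hvh huv))
    · refine OutsideLinked.symm ⟨B₂ ++ [u], y₂, u, wB₂.append e.adj_bu (.single H u), ht₂y₂,
        huv, ?_⟩
      intro x hx
      rcases List.mem_append.1 hx with hx | hx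
      · rintro ⟨rfl | h1, rfl | h2⟩
        · exact (dβ x mt₂).2.2 rfl
        · have := (List.nodup_append.1 (List.nodup_append.1 (List.nodup_append.1
            (List.nodup_append.1 e.nodup).1).1).2.1).2.2
          exact this x wB₁.last_mem x hx rfl
        · exact (dβ x (by simp [hx])).2.2 rfl
        · exact hB₂K x hx h2.symm h1
      · obtain rfl := List.mem_singleton.1 hx
        rintro ⟨h' | h', -⟩
        · exact (dβ _ mt₂).2.1 h'.symm
        · exact nt₂u h'.symm
  have ot₁u : OutsideLinked H t₁ u := by
    refine ⟨A₂ ++ [v] ++ R.reverse, y₁, h, (wA₂.append e.adj_av (.single H v)).append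
      e.adj_sv.symm e.walk_ear.reverse, ht₁y₁, e.adj_uh.symm, ?_⟩
    intro x hx
    simp only [List.mem_append, List.mem_singleton, List.mem_reverse] at hx
    rcases hx with (hx | rfl) | hx
    · exact fun h' => hA₂u x hx h'.2
    · rintro ⟨-, h' | h'⟩
      · exact duv h'.symm
      · exact huv h'.symm
    · rintro ⟨h' | h', -⟩
      · exact hαR _ mt₁ _ hx (.inl h'.symm)
      · exact hαR _ mt₁ _ hx (.inr h'.symm)
  obtain ⟨R₁, rfl⟩ := e.walk_ear.exists_cons
  rcases eq_or_ne R₁ [] with rfl | hR₁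
  · obtain ⟨-, rfl⟩ := e.walk_ear.eq_of_singleton
    refine ⟨![y₁, t₁, u, s, v, t₂], isInducedP6_of ht₁y₁.symm hut₁.symm e.adj_uh e.adj_sv hvt₂
      (fun h' => nuy₁ h'.symm) (e.far _ my₁ _ mh) (fun h' => nvy₁ h'.symm) ny₁t₂
      (e.far _ mt₁ _ mh) nt₁v nt₁t₂ huv (fun h' => nt₂u h'.symm) (fun h' => nst₂ h'.symm),
      ot₁u, ?_, ?_⟩
    · refine ⟨A₁ ++ A₂ ++ [v], a, v, e.walk_left.append e.adj_av (.single H v), e.adj_ua,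
        e.adj_sv.symm, ?_⟩
      intro x hx
      rcases List.mem_append.1 hx with hx | hx
      · exact fun h' => hαR x hx s mh h'.2
      · obtain rfl := List.mem_singleton.1 hx
        rintro ⟨h' | h', -⟩
        · exact duv h'.symm
        · exact huv h'.symm
    · refine ⟨[u] ++ (A₁ ++ A₂), u, a', (WalkList.single H u).append e.adj_ua e.walk_left,
        e.adj_uh.symm, e.adj_av, ?_⟩
      intro x hx
      rcases List.mem_append.1 hx with hx | hx
      · obtain rfl := List.mem_singleton.1 hx
        rintro ⟨-, h' | h'⟩
        · exact duv h'
        · exact huv h'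
      · exact fun h' => hαR x hx s mh h'.1
  obtain ⟨h₀, h₂, w1, hhh₂, w2⟩ := WalkList.split (l := [h]) (m := R₁) e.walk_ear (by simp) hR₁
  obtain rfl := w1.eq_of_singleton.2
  have hlen : 0 < R₁.length := List.length_pos_of_ne_nil hR₁
  have nuR : ∀ x ∈ R₁, ¬ H.Adj u x := fun x hx hux => by
    have hs₂ : ∃ R₂, WalkList H x R₂ s ∧ R₂.Sublist R₁ := by
      rcases eq_or_ne x h₂ with rfl | hne
      · exact ⟨R₁, w2, .refl _⟩
      · obtain ⟨l₁, l₂, p, rfl, -, -, h4⟩ := w2.split_before hx hne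
        exact ⟨l₂, h4, List.sublist_append_right _ _⟩
    obtain ⟨R₂, k1, k2⟩ := hs₂
    have := e.short R₂ x s k1 (k2.trans (List.sublist_cons_self _ _)) hux e.adj_sv
    have := k2.length_le
    simp at *
    omega
  have nhv : ¬ H.Adj h₀ v := fun h' => by
    have := e.short [h₀] h₀ h₀ (.single H h₀) (by simp) e.adj_uh h'
    simp at this
    exact hR₁ this
  have ouh : OutsideLinked H u h₀ := by
    refine ⟨A₁ ++ A₂ ++ [v] ++ R₁.reverse, a, h₂, (e.walk_left.append e.adj_av
      (.single H v)).append e.adj_sv.symm w2.reverse, e.adj_ua, hhh₂.symm, ?_⟩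
    intro x hx
    rw [List.mem_append, List.mem_append, List.mem_singleton, List.mem_reverse] at hx
    rcases hx with (hx | rfl) | hx
    · exact fun h' => hαR x hx h₀ mh h'.2
    · rintro ⟨h' | h', -⟩
      · exact duv h'.symm
      · exact huv h'.symm
    · rintro ⟨h' | h', -⟩
      · exact (dR x (by simp [hx])).1 h'
      · exact nuR x hx h'.symm
  have mh₂ : h₂ ∈ R₁ := w2.head_mem
  have mh₂' : h₂ ∈ h₀ :: R₁ := by simp [mh₂]
  obtain ⟨R₂, rfl⟩ := w2.exists_cons
  have wuv : WalkList H u ([u] ++ (A₁ ++ A₂) ++ [v]) v :=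
    ((WalkList.single H u).append e.adj_ua e.walk_left).append e.adj_av (.single H v)
  have huvK : ∀ x ∈ [u] ++ (A₁ ++ A₂) ++ [v],
      ¬ ((x = h₀ ∨ H.Adj x h₀) ∧ (x = h₂ ∨ H.Adj x h₂)) := by
    intro x hx
    rw [List.mem_append, List.mem_append, List.mem_singleton, List.mem_singleton] at hx
    rcases hx with (rfl | hx) | rfl
    · rintro ⟨-, h' | h'⟩
      · exact (dR _ mh₂').1 h'.symm
      · exact nuR _ mh₂ h'
    · exact fun h' => hαR x hx h₀ mh h'.1
    · rintro ⟨h' | h', -⟩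
      · exact (dR _ mh).2 h'.symm
      · exact nhv h'.symm
  rcases eq_or_ne R₂ [] with rfl | hR₂
  · obtain ⟨-, rfl⟩ := w2.eq_of_singleton
    exact ⟨![y₁, t₁, u, h₀, s, v], isInducedP6_of ht₁y₁.symm hut₁.symm e.adj_uh hhh₂ e.adj_sv
      (fun h' => nuy₁ h'.symm) (e.far _ my₁ _ mh) (e.far _ my₁ _ mh₂') (fun h' => nvy₁ h'.symm)
      (e.far _ mt₁ _ mh) (e.far _ mt₁ _ mh₂') nt₁v (nuR _ mh₂) huv nhv,
      ot₁u, ouh, _, _, _, wuv, e.adj_uh.symm, e.adj_sv.symm, huvK⟩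
  obtain ⟨h₁, h₃, w4, hh₂₃, w5⟩ := WalkList.split (l := [h₂]) (m := R₂) w2 (by simp) hR₂
  obtain rfl := w4.eq_of_singleton.2
  have nhR : ∀ x ∈ R₂, ¬ H.Adj h₀ x := fun x hx hhx => by
    have hs₂ : ∃ R₃, WalkList H x R₃ s ∧ R₃.Sublist R₂ := by
      rcases eq_or_ne x h₃ with rfl | hne
      · exact ⟨R₂, w5, .refl _⟩
      · obtain ⟨l₁, l₂, p, rfl, -, -, h4⟩ := w5.split_before hx hne
        exact ⟨l₂, h4, List.sublist_append_right _ _⟩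
    obtain ⟨R₃, k1, k2⟩ := hs₂
    have := e.short ([h₀] ++ R₃) h₀ s ((WalkList.single H h₀).append hhx k1)
      (by simpa using k2.trans (List.sublist_cons_self _ _)) e.adj_uh e.adj_sv
    have := k2.length_le
    simp at *
    omega
  have mh₃ : h₃ ∈ R₂ := w5.head_mem
  refine ⟨![y₁, t₁, u, h₀, h₁, h₃], isInducedP6_of ht₁y₁.symm hut₁.symm e.adj_uh hhh₂ hh₂₃
    (fun h' => nuy₁ h'.symm) (e.far _ my₁ _ mh) (e.far _ my₁ _ mh₂')
    (e.far _ my₁ _ (by simp [mh₃])) (e.far _ mt₁ _ mh) (e.far _ mt₁ _ mh₂')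
    (e.far _ mt₁ _ (by simp [mh₃])) (nuR _ mh₂) (nuR _ (by simp [mh₃])) (nhR _ mh₃),
    ot₁u, ouh, [u] ++ (A₁ ++ A₂) ++ [v] ++ R₂.reverse, u, h₃,
    wuv.append e.adj_sv.symm w5.reverse, e.adj_uh.symm, hh₂₃.symm, ?_⟩
  intro x hx
  rcases List.mem_append.1 hx with hx | hx
  · exact huvK x hx
  · rw [List.mem_reverse] at hx
    rintro ⟨rfl | h', -⟩
    · have := (List.nodup_append.1 (List.nodup_append.1 e.nodup).1).2.1
      simp [hx] at this
    · exact nhR x hx h'.symm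

end IsEar

lemma exists_longest_cycle [Fintype V] {H : SimpleGraph V} {a b : V} (hab : H.Adj a b) :
    ∃ C, IsCycleList H C ∧ ∀ m, IsCycleList H m → m.length ≤ C.length := by
  have hne : {l | IsCycleList H l}.Nonempty :=
    ⟨[a] ++ [b], by simp [hab.ne], a, b, (WalkList.single H a).append hab (.single H b), hab.symm⟩
  obtain ⟨C, hC, hmin⟩ := WellFounded.has_min
    (measure fun l : List V => Fintype.card V - l.length).wf _ hne
  refine ⟨C, hC, fun m hm => ?_⟩
  have h1 : ¬ Fintype.card V - m.length < Fintype.card V - C.length := hmin m hm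
  have h2 := List.Nodup.length_le_card hm.1
  omega

/-- In a 2-connected graph any two vertices are joined by a walk avoiding a given third vertex. -/
lemma TwoConnected.exists_walkList [Fintype V] {G : SimpleGraph V} (hG : TwoConnected G)
    {w t c : V} (hw : w ≠ c) (ht : t ≠ c) : ∃ l, WalkList G w l t ∧ c ∉ l := by
  obtain ⟨p⟩ := (hG.2 c).preconnected ⟨w, hw⟩ ⟨t, ht⟩
  refine ⟨_, (p.map (Embedding.induce _).toHom).walkList_support, ?_⟩
  intro h
  obtain ⟨x, -, hx⟩ := List.mem_map.1 ((Walk.support_map _ _) ▸ h)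
  exact x.2 hx

lemma WalkList.exists_nodup {G : SimpleGraph V} {a b : V} {l : List V} (h : WalkList G a l b) :
    ∃ m, WalkList G a m b ∧ m.Nodup ∧ ∀ x ∈ m, x ∈ l := by
  classical
  obtain ⟨p, rfl⟩ := h.exists_walk
  exact ⟨_, p.bypass.walkList_support, p.bypass_isPath.support_nodup,
    fun x hx => p.support_bypass_subset_support hx⟩

lemma IsCycleList.exists_ne_mem {H : SimpleGraph V} {C : List V} (hC : IsCycleList H C) (c : V) :
    ∃ x ∈ C, x ≠ c := by
  obtain ⟨-, a, b, h, hba⟩ := hC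
  rcases eq_or_ne a c with rfl | hac
  · exact ⟨b, h.last_mem, hba.ne⟩
  · exact ⟨a, h.head_mem, hac⟩

/-- From outside a cycle one reaches the cycle at a vertex different from `c ∈ C`. -/
lemma TwoConnected.exists_to_cycle [Fintype V] {G H : SimpleGraph V} (hG : TwoConnected G)
    (hGH : G ≤ H) {C : List V} (hC : IsCycleList H C) {w c : V} (hw : w ∉ C) (hc : c ∈ C) :
    ∃ l p t, WalkList H w l p ∧ H.Adj p t ∧ t ∈ C ∧ t ≠ c ∧ ∀ x ∈ l, x ∉ C := by
  obtain ⟨c', hc', hcc'⟩ := hC.exists_ne_mem c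
  obtain ⟨l, hl, hcl⟩ := hG.exists_walkList (w := w) (t := c') (c := c)
    (by rintro rfl; exact hw hc) hcc'
  obtain ⟨l₁, t, l₂, rfl, ht, h₁⟩ := exists_first (P := (· ∈ C)) ⟨c', hl.last_mem, hc'⟩
  have hne : l₁ ≠ [] := by
    rintro rfl
    have := hl.2.1
    simp at this
    exact hw (this ▸ ht)
  rw [List.append_assoc] at hl
  obtain ⟨p, t', k1, k2, k3⟩ := hl.split hne (by simp)
  obtain rfl : t = t' := by simpa using k3.2.1
  exact ⟨l₁, p, t, k1.mono hGH, hGH k2, ht, by rintro rfl; simp at hcl, h₁⟩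

/-- `R` is a path outside `C` joining vertices `u`, `v` of `C` that cut `C` into `α` and `β`. -/
def IsEarOf (H : SimpleGraph V) (C : List V) (u v h s : V) (α β R : List V) : Prop :=
  IsCycleList H (u :: (α ++ v :: β)) ∧ (u :: (α ++ v :: β)).Perm C ∧ WalkList H h R s ∧
    R.Nodup ∧ H.Adj u h ∧ H.Adj s v ∧ ∀ x ∈ R, x ∉ C

lemma TwoConnected.exists_isEarOf [Fintype V] {G H : SimpleGraph V} (hG : TwoConnected G)
    (hGH : G ≤ H) {C : List V} (hC : IsCycleList H C) {w : V} (hw : w ∉ C) :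
    ∃ u v h s α β R, IsEarOf H C u v h s α β R := by
  obtain ⟨c, hc, -⟩ := hC.exists_ne_mem w
  obtain ⟨l, p, u, hl, hpu, hu, -, hlC⟩ := hG.exists_to_cycle hGH hC hw hc
  obtain ⟨m, q, v, hm, hqv, hv, hvu, hmC⟩ := hG.exists_to_cycle hGH hC hw hu
  obtain ⟨k, hk, hkm⟩ := hl.reverse.trans hm
  obtain ⟨R, hR, hRn, hRk⟩ := hk.exists_nodup
  obtain ⟨l₁, l₂, rfl⟩ := List.append_of_mem hu
  have hv' : v ∈ l₂ ++ l₁ := by simp at hv ⊢; tauto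
  obtain ⟨α, β, hαβ⟩ := List.append_of_mem hv'
  have hrot := hC.rotate
  rw [List.cons_append, hαβ] at hrot
  refine ⟨u, v, p, q, α, β, R, hrot, ?_, hR, hRn, hpu.symm, hqv, fun x hx => ?_⟩
  · rw [← hαβ, ← List.cons_append]
    exact List.perm_append_comm
  · rcases hkm x (hRk x hx) with h | h
    · exact hlC x (by simpa using h)
    · exact hmC x h

lemma TwoConnected.exists_isEar [Fintype V] {G H : SimpleGraph V} (hG : TwoConnected G)
    (hGH : G ≤ H) (hH : ¬ HasHamCycle H) :
    ∃ u v a a' b b' h s α β R, IsEar H u v a a' b b' h s α β R := by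
  classical
  have hcon : ∃ a b, H.Adj a b := by
    obtain ⟨c, w, t, h1, h2, h3⟩ := Fintype.two_lt_card_iff.1 hG.1
    obtain ⟨l, hl, -⟩ := hG.exists_walkList (w := w) (t := t) (c := c) h1.symm h2.symm
    obtain ⟨k, rfl⟩ := hl.exists_cons
    have hk : k ≠ [] := by
      rintro rfl
      exact h3 hl.eq_of_singleton.2.symm
    obtain ⟨a, b, -, h, -⟩ := WalkList.split (l := [w]) (m := k) hl (by simp) hk
    exact ⟨a, b, hGH h⟩
  obtain ⟨_, _, hcon⟩ := hcon
  obtain ⟨C, hC, hmax⟩ := exists_longest_cycle hcon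
  have hw : ∃ w, w ∉ C := by
    by_contra! h
    exact hH ⟨C, hC, h⟩
  obtain ⟨w, hw⟩ := hw
  have hex : ∃ n, ∃ u v h s α β R, IsEarOf H C u v h s α β R ∧ α.length = n := by
    obtain ⟨u, v, h, s, α, β, R, hE⟩ := hG.exists_isEarOf hGH hC hw
    exact ⟨_, u, v, h, s, α, β, R, hE, rfl⟩
  have hex2 : ∃ k, ∃ u v h s α β R, IsEarOf H C u v h s α β R ∧ α.length = Nat.find hex ∧
      R.length = k := by
    obtain ⟨u, v, h, s, α, β, R, hE, hl⟩ := Nat.find_spec hex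
    exact ⟨_, u, v, h, s, α, β, R, hE, hl, rfl⟩
  obtain ⟨u, v, h, s, α, β, R, hE, hα, hR⟩ := Nat.find_spec hex2
  have hminα : ∀ {u v h s α' β R}, IsEarOf H C u v h s α' β R → α.length ≤ α'.length :=
    fun hE => hα ▸ Nat.find_min' hex ⟨_, _, _, _, _, _, _, hE, rfl⟩
  have hminR : ∀ {h s R'}, IsEarOf H C u v h s α β R' → R.length ≤ R'.length :=
    fun hE => hR ▸ Nat.find_min' hex2 ⟨_, _, _, _, _, _, _, hE, hα, rfl⟩
  obtain ⟨hcyc, hperm, hRw, hRn, huh, hsv, hRC⟩ := hE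
  have hlen := hperm.length_eq
  have hmem : ∀ x, x ∈ R → x ∉ u :: (α ++ v :: β) := fun x hx => by
    rw [hperm.mem_iff]; exact hRC x hx
  have hnodup : (α ++ β ++ R ++ [u, v]).Nodup := by
    have : (u :: (α ++ v :: β) ++ R).Nodup := by
      rw [List.nodup_append]
      exact ⟨hcyc.1, hRn, fun a ha b hb e => hmem b hb (e ▸ ha)⟩
    refine (List.Perm.nodup_iff ?_).1 this
    rw [List.perm_iff_count]; intro
    simp only [List.count_append, List.count_cons, List.count_nil]; omega
  have hnotlonger : ∀ {m x y}, WalkList H x m y → H.Adj y x → m.Perm (α ++ β ++ R ++ [u, v]) →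
      False := fun hm hyx hp => by
    have h1 := hmax _ ⟨hp.nodup_iff.2 hnodup, _, _, hm, hyx⟩
    have h2 := hp.length_eq
    have h3 := List.length_pos_of_ne_nil hRw.ne_nil
    simp at h2 hlen
    omega
  obtain ⟨-, c, d, hw, hdc⟩ := hcyc
  obtain rfl : u = c := by simpa using hw.2.1
  obtain ⟨c, d', w1, huc, w2⟩ := WalkList.split (l := [u]) (m := α ++ v :: β) hw (by simp)
    (by simp)
  obtain rfl := w1.eq_of_singleton.2
  have hαne : α ≠ [] := by
    rintro rfl
    obtain ⟨t, ht⟩ := w2.exists_cons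
    simp only [List.nil_append, List.cons.injEq] at ht
    obtain ⟨rfl, rfl⟩ := ht
    exact hnotlonger (((WalkList.single H c).append huh hRw).append hsv w2) hdc
      (by rw [List.perm_iff_count]; intro
          simp only [List.count_append, List.count_cons, List.count_nil]; omega)
  obtain ⟨a', v', wα, hav, w3⟩ := w2.split hαne (by simp)
  obtain rfl : v = v' := by simpa using w3.2.1
  have hβne : β ≠ [] := by
    rintro rfl
    obtain ⟨-, rfl⟩ := w3.eq_of_singleton
    exact hnotlonger ((((WalkList.single H c).append huc wα).append hav w3).append hsv.symm
      hRw.reverse) huh.symm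
      (by rw [List.perm_iff_count]; intro
          simp only [List.count_append, List.count_cons, List.count_nil, List.count_reverse]; omega)
  obtain ⟨v', b, w4, hvb, wβ⟩ := WalkList.split (l := [v]) (m := β) w3 (by simp) hβne
  obtain rfl := w4.eq_of_singleton.2
  refine ⟨c, v', d', a', b, d, h, s, α, β, R, wα, wβ, hRw, huc, hav, hvb, hdc, huh, hsv, hnodup,
    ?_, ?_, ?_⟩
  · intro m hm
    have := hmax m hm
    simp at hlen
    omega
  · intro t ht r hr htr
    obtain ⟨α₁, α₂, rfl⟩ := List.append_of_mem ht
    have hR' : ∃ R', WalkList H h R' r ∧ R'.Sublist R := by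
      by_cases hrs : r = s
      · exact ⟨R, hrs ▸ hRw, .refl _⟩
      · obtain ⟨l₁, l₂, p, e, -, -, h4⟩ := hRw.reverse.split_before (by simpa using hr) hrs
        refine ⟨l₂.reverse, h4.reverse, ?_⟩
        rw [← List.reverse_sublist, e, List.reverse_reverse]
        exact List.sublist_append_right _ _
    obtain ⟨R', hR'w, hR's⟩ := hR'
    have := hminα (u := c) (v := t) (h := h) (s := r) (α' := α₁) (β := α₂ ++ v' :: β) (R := R') (by
      refine ⟨⟨?_, c, d, by simpa using hw, hdc⟩, by simpa using hperm, hR'w, hR's.nodup hRn, huh,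
        htr.symm, fun x hx => hRC x (hR's.subset hx)⟩
      have := hperm.nodup_iff.2 hC.1
      simpa using this)
    simp at this
  · intro R' h' s' hw' hs' hc1 hc2
    exact hminR ⟨⟨hperm.nodup_iff.2 hC.1, c, d, hw, hdc⟩, hperm, hw', hs'.nodup hRn, hc1, hc2,
      fun x hx => hRC x (hs'.subset hx)⟩

/-- `r 0, …, r L` is a shortest path of `F`. -/
structure IsGeodesic (F : SimpleGraph V) (L : ℕ) (r : ℕ → V) : Prop where
  adj : ∀ i < L, F.Adj (r i) (r (i + 1))
  ne : ∀ i j, i < j → j ≤ L → r i ≠ r j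
  not_adj : ∀ i j, i + 2 ≤ j → j ≤ L → ¬ F.Adj (r i) (r j)
  no_common : ∀ i j c, i + 3 ≤ j → j ≤ L → F.Adj (r i) c → ¬ F.Adj c (r j)

lemma exists_isGeodesic {F : SimpleGraph V} {a b : V} (h : F.Reachable a b) :
    ∃ L r, r 0 = a ∧ r L = b ∧ IsGeodesic F L r := by
  obtain ⟨p, hp⟩ := h.exists_walk_length_eq_dist
  have key : ∀ i j, j ≤ p.length → ∀ w : F.Walk (p.getVert i) (p.getVert j),
      j ≤ i + w.length := by
    intro i j hj w
    have h1 := dist_le ((p.take i).append (w.append (p.drop j)))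
    simp only [Walk.length_append, Walk.take_length, Walk.drop_length] at h1
    omega
  refine ⟨p.length, p.getVert, p.getVert_zero, p.getVert_length,
    fun i hi => p.adj_getVert_succ hi, fun i j hij hj he => ?_, fun i j hij hj he => ?_,
    fun i j c hij hj h1 h2 => ?_⟩
  · have := key i j hj (Walk.nil.copy rfl he)
    simp at this
    omega
  · have := key i j hj he.toWalk
    simp at this
    omega
  · have := key i j hj (.cons h1 h2.toWalk)
    simp at this
    omega

/-- The spanning subgraph of `G` whose edges are those with both ends in `S`. -/
def restrictTo (G : SimpleGraph V) (S : V → Prop) : SimpleGraph V where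
  Adj x y := G.Adj x y ∧ S x ∧ S y
  symm := ⟨fun _ _ h => ⟨h.1.symm, h.2.2, h.2.1⟩⟩
  loopless := ⟨fun _ h => h.1.ne rfl⟩

lemma WalkList.reachable_restrictTo {G : SimpleGraph V} {S : V → Prop} {a b : V} {l : List V}
    (h : WalkList G a l b) (hS : ∀ x ∈ l, S x) : (restrictTo G S).Reachable a b := by
  obtain ⟨p, rfl⟩ := h.exists_walk
  clear h
  induction p with
  | nil => exact .refl _
  | cons e p ih =>
    simp only [Walk.support_cons, List.mem_cons, forall_eq_or_imp] at hS
    exact Reachable.trans (Adj.reachable ⟨e, hS.1, hS.2 _ p.start_mem_support⟩) (ih hS.2)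

/-- The `P₆`-`γ₃` condition in terms of `dg`. -/
def HeavyPaths [Fintype V] (G : SimpleGraph V) : Prop :=
  ∀ v : Fin 6 → V, IsInducedP6 G v → ∃ i j : Fin 6, s(i, j) ∈ gamma3 ∧
    Fintype.card V ≤ dg G (v i) + dg G (v j)

lemma IsClosureOf.not_heavy [Fintype V] {G H : SimpleGraph V} (hcl : IsClosureOf G H) {u v : V}
    (huv : u ≠ v) (h : ¬ H.Adj u v) : dg G u + dg G v < Fintype.card V :=
  not_le.1 fun hh => h (hcl.heavy u v huv hh)

/-- Nonadjacent vertices of `G` that are heavy have a common neighbour simplicial in the closure. -/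
lemma IsClosureOf.exists_simplicial [Fintype V] {G H : SimpleGraph V} (hcl : IsClosureOf G H)
    {a b : V} (hab : a ≠ b) (hnab : ¬ G.Adj a b)
    (hh : Fintype.card V ≤ dg G a + dg G b) : ∃ c, G.Adj a c ∧ G.Adj b c ∧ Simplicial H c := by
  by_contra! hno
  have hH : H.Adj a b := hcl.heavy a b hab hh
  have hex : ∀ c, ∃ c', G.Adj a c → G.Adj b c → H.Adj c c' ∧ c' ≠ a ∧ c' ≠ b ∧
      ¬ H.Adj a c' ∧ ¬ H.Adj b c' := by
    intro c
    by_cases hc : G.Adj a c ∧ G.Adj b c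
    swap
    · exact ⟨c, fun h1 h2 => (hc ⟨h1, h2⟩).elim⟩
    have hac := hcl.le hc.1
    have hbc := hcl.le hc.2
    by_contra! hcon
    refine hno c hc.1 hc.2 fun s t hs ht hst => ?_
    have hK : ∀ z, H.Adj c z → (z = a ∨ H.Adj a z) ∧ (z = b ∨ H.Adj b z) := by
      intro z hz
      by_cases hza : z = a
      · subst hza
        exact ⟨.inl rfl, .inr hH.symm⟩
      by_cases hzb : z = b
      · subst hzb
        exact ⟨.inr hH, .inl rfl⟩
      by_cases haz : H.Adj a z
      · exact ⟨.inr haz, .inr (hcl.diamond c b a z hbc.symm hac.symm hz (Ne.symm hzb) hH.symm haz)⟩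
      · have hbz := (hcon z).2.2 hz hza hzb haz
        exact (haz (hcl.diamond c a b z hac.symm hbc.symm hz (Ne.symm hza) hH hbz)).elim
    obtain ⟨h1, h2⟩ := hK s hs
    obtain ⟨h3, h4⟩ := hK t ht
    rcases h1 with rfl | h1
    · exact h3.resolve_left (Ne.symm hst)
    rcases h3 with rfl | h3
    · exact h1.symm
    exact hcl.diamond c s a t hs hac.symm ht hst h1.symm h3
  choose f hf using hex
  refine absurd hh (not_le.2 (dg_add_dg_lt hab hnab f (fun c h1 h2 => ?_) ?_))
  · obtain ⟨-, h3, h4, h5, h6⟩ := hf c h1 h2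
    exact ⟨h3, h4, fun h => h5 (hcl.le h), fun h => h6 (hcl.le h)⟩
  · intro c d h1 h2 h3 h4 he
    by_contra hcd
    obtain ⟨h5, h6, -, h7, -⟩ := hf c h1 h2
    obtain ⟨h8, -⟩ := hf d h3 h4
    have hcd' : H.Adj c d :=
      hcl.diamond a c b d (hcl.le h1) hH (hcl.le h3) hcd (hcl.le h2).symm (hcl.le h4)
    rw [he] at h5 h6 h7
    exact h7 (hcl.diamond c a d (f d) (hcl.le h1).symm hcd' h5 (Ne.symm h6) (hcl.le h3) h8)

/-- In an induced `P₆`, given as a list of vertices, one of the seven `γ₃`-pairs is heavy. -/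
lemma HeavyPaths.exists_heavy [Fintype V] {G : SimpleGraph V} (hP : HeavyPaths G)
    {a b c d e f : V} (h : IsInducedP6 G ![a, b, c, d, e, f]) :
    Fintype.card V ≤ dg G a + dg G c ∨ Fintype.card V ≤ dg G a + dg G d ∨
    Fintype.card V ≤ dg G a + dg G e ∨ Fintype.card V ≤ dg G b + dg G e ∨
    Fintype.card V ≤ dg G b + dg G f ∨ Fintype.card V ≤ dg G c + dg G f ∨
    Fintype.card V ≤ dg G d + dg G f := by
  obtain ⟨i, j, hij, hh⟩ := hP _ h
  simp only [gamma3, Set.mem_insert_iff, Set.mem_singleton_iff, Sym2.eq_iff] at hij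
  rcases hij with h | h | h | h | h | h | h <;>
    rcases h with ⟨rfl, rfl⟩ | ⟨rfl, rfl⟩ <;>
    simp [add_comm] at hh <;> grind

/-- `q` is a simplicial common neighbour of `a` and `b`. -/
def Middle (H : SimpleGraph V) (a b q : V) : Prop := Simplicial H q ∧ H.Adj q a ∧ H.Adj q b

/-- `z` belongs to the common closed neighbourhood of `a` and `b`. -/
def InCommon (H : SimpleGraph V) (a b z : V) : Prop := (z = a ∨ H.Adj z a) ∧ (z = b ∨ H.Adj z b)

lemma Middle.inCommon {H : SimpleGraph V} {a b q z : V} (hq : Middle H a b q) (h : H.Adj q z) :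
    InCommon H a b z := by
  refine ⟨?_, ?_⟩
  · by_contra! hz
    exact hz.2 (hq.1 _ _ h hq.2.1 hz.1)
  · by_contra! hz
    exact hz.2 (hq.1 _ _ h hq.2.2 hz.1)

lemma Middle.not_heavy [Fintype V] {G H : SimpleGraph V} (hcl : IsClosureOf G H) {a b q z : V}
    (hq : Middle H a b q) (hz : ¬ InCommon H a b z) : dg G q + dg G z < Fintype.card V :=
  hcl.not_heavy (by rintro rfl; exact hz ⟨.inr hq.2.1, .inr hq.2.2⟩) fun h => hz (hq.inCommon h)

/-- If `a` and `b` are linked outside their clique in `H`, then so they are in `G`. -/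
lemma OutsideLinked.reachable [Fintype V] {G H : SimpleGraph V} (hcl : IsClosureOf G H) {a b : V}
    (h : OutsideLinked H a b) :
    (restrictTo G fun z => z = a ∨ z = b ∨ ¬ InCommon H a b z).Reachable a b := by
  set S : V → Prop := fun z => z = a ∨ z = b ∨ ¬ InCommon H a b z with hS
  have step : ∀ x y, H.Adj x y → S x → S y → ¬ InCommon H a b x ∨ ¬ InCommon H a b y →
      (restrictTo G S).Reachable x y := by
    intro x y hxy hx hy hout
    obtain ⟨l, hl, hr⟩ := hcl.linked x y hxy
    refine hl.reachable_restrictTo fun r hrl => ?_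
    rcases hr r hrl with rfl | rfl | ⟨hs, hrx, hry⟩
    · exact hx
    · exact hy
    · by_contra hSr
      simp only [hS, not_or, not_not] at hSr
      obtain ⟨hra, hrb, hK⟩ := hSr
      have hm : Middle H a b r := ⟨hs, hK.1.resolve_left hra, hK.2.resolve_left hrb⟩
      exact hout.elim (fun h => h (hm.inCommon hrx)) fun h => h (hm.inCommon hry)
  obtain ⟨σ, c, d, hσ, hac, hdb, hout⟩ := h
  have hmid : ∀ (c d : V) (p : H.Walk c d), (∀ x ∈ p.support, ¬ InCommon H a b x) →
      (restrictTo G S).Reachable c d := by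
    intro c d p
    induction p with
    | nil => exact fun _ => .refl _
    | cons e p ih =>
      intro h
      simp only [Walk.support_cons, List.mem_cons, forall_eq_or_imp] at h
      exact (step _ _ e (.inr (.inr h.1)) (.inr (.inr (h.2 _ p.start_mem_support)))
        (.inl h.1)).trans (ih h.2)
  obtain ⟨p, rfl⟩ := hσ.exists_walk
  have hc := hout c p.start_mem_support
  have hd := hout d p.end_mem_support
  exact ((step a c hac (.inl rfl) (.inr (.inr hc)) (.inr hc)).trans (hmid c d p hout)).trans
    (step d b hdb (.inr (.inr hd)) (.inr (.inl rfl)) (.inl hd))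

lemma not_heavy_of_outsideLinked [Fintype V] {G H : SimpleGraph V} (hcl : IsClosureOf G H)
    (hP : HeavyPaths G) {a b q₁ q₂ u w : V} (hab : H.Adj a b) (hout : OutsideLinked H a b)
    (hq₁ : Middle H a b q₁) (hq₂ : Middle H a b q₂) (hu : Middle H a b u) (hw : Middle H a b w)
    (haq₁ : G.Adj q₁ a) (hbq₂ : G.Adj b q₂) (hq : ¬ G.Adj q₁ q₂) (hq₁b : ¬ G.Adj q₁ b)
    (haq₂ : ¬ G.Adj a q₂) (hnab : ¬ G.Adj a b)
    (hhq₁b : dg G q₁ + dg G b < Fintype.card V) (hhaq₂ : dg G a + dg G q₂ < Fintype.card V)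
    (hhaw : dg G a + dg G w < Fintype.card V)
    (hhbu : dg G b + dg G u < Fintype.card V) : dg G u + dg G w < Fintype.card V := by
  by_contra! huw
  obtain ⟨m, o, ho0, hom, ho⟩ := exists_isGeodesic (hout.reachable hcl)
  have hm0 : m ≠ 0 := by
    rintro rfl
    exact hab.ne (ho0.symm.trans hom)
  have hmem : ∀ i ≤ m, o i = a ∨ o i = b ∨ ¬ InCommon H a b (o i) := by
    intro i hi
    rcases i with _ | i
    · exact .inl ho0
    · exact (ho.adj i (by omega)).2.2
  have hin : ∀ i, 0 < i → i < m → ¬ InCommon H a b (o i) := by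
    intro i hi him
    rcases hmem i him.le with h | h | h
    · exact (ho.ne 0 i hi him.le (ho0.trans h.symm)).elim
    · exact (ho.ne i m him le_rfl (h.trans hom.symm)).elim
    · exact h
  have hadj : ∀ i < m, G.Adj (o i) (o (i + 1)) := fun i hi => (ho.adj i hi).1
  have hnadj : ∀ i j, i + 2 ≤ j → j ≤ m → ¬ G.Adj (o i) (o j) := fun i j hij hj h =>
    ho.not_adj i j hij hj ⟨h, hmem i (by omega), hmem j hj⟩
  have hq₁o : ∀ j, 0 < j → j ≤ m → ¬ G.Adj q₁ (o j) ∧ dg G q₁ + dg G (o j) < Fintype.card V := by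
    intro j hj hjm
    rcases hjm.eq_or_lt with rfl | hjm
    · rw [hom]
      exact ⟨hq₁b, hhq₁b⟩
    · exact ⟨fun h => hin j hj hjm (hq₁.inCommon (hcl.le h)), hq₁.not_heavy hcl (hin j hj hjm)⟩
  have hoo : ∀ i j, i < j → j ≤ m → dg G (o i) + dg G (o j) < Fintype.card V := by
    intro i j hij hj
    have h1 : dg G (o i) + dg G w < Fintype.card V := by
      rcases Nat.eq_zero_or_pos i with rfl | hi
      · rwa [ho0]
      · rw [add_comm]
        exact hw.not_heavy hcl (hin i hi (by omega))
    have h2 : dg G (o j) + dg G u < Fintype.card V := by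
      rcases hj.eq_or_lt with rfl | hj
      · rwa [hom]
      · rw [add_comm]
        exact hu.not_heavy hcl (hin j (by omega) hj)
    omega
  have hm3 : 3 ≤ m := by
    by_contra! hlt
    have h1 : m ≠ 1 := by
      rintro rfl
      have := hadj 0 (by omega)
      rw [ho0, hom] at this
      exact hnab this
    obtain rfl : m = 2 := by omega
    have h2 := hadj 0 (by omega)
    have h3 := hadj 1 (by omega)
    rw [ho0] at h2
    rw [hom] at h3
    exact hin 1 (by omega) (by omega) ⟨.inr (hcl.le h2).symm, .inr (hcl.le h3)⟩
  have h01 : G.Adj q₁ (o 0) := ho0 ▸ haq₁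
  rcases hm3.eq_or_lt with rfl | hm4
  · have hq₂o : ∀ j < 3, ¬ G.Adj (o j) q₂ ∧ dg G (o j) + dg G q₂ < Fintype.card V := by
      intro j hj
      rcases Nat.eq_zero_or_pos j with rfl | hj0
      · rw [ho0]
        exact ⟨haq₂, hhaq₂⟩
      · exact ⟨fun h => hin j hj0 hj (hq₂.inCommon (hcl.le h).symm),
          add_comm (dg G q₂) _ ▸ hq₂.not_heavy hcl (hin j hj0 hj)⟩
    have h45 : G.Adj (o 3) q₂ := hom ▸ hbq₂
    have := hP.exists_heavy (isInducedP6_of h01 (hadj 0 (by omega)) (hadj 1 (by omega))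
      (hadj 2 (by omega)) h45 (hq₁o 1 (by omega) (by omega)).1 (hq₁o 2 (by omega) (by omega)).1
      (hq₁o 3 (by omega) (by omega)).1 hq (hnadj 0 2 (by omega) (by omega))
      (hnadj 0 3 (by omega) (by omega)) (hq₂o 0 (by omega)).1 (hnadj 1 3 (by omega) (by omega))
      (hq₂o 1 (by omega)).1 (hq₂o 2 (by omega)).1)
    simp only [Nat.reduceAdd] at this
    have := (hq₁o 1 (by omega) (by omega)).2
    have := (hq₁o 2 (by omega) (by omega)).2
    have := (hq₁o 3 (by omega) (by omega)).2
    have := hoo 0 3 (by omega) (by omega)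
    have := (hq₂o 0 (by omega)).2
    have := (hq₂o 1 (by omega)).2
    have := (hq₂o 2 (by omega)).2
    omega
  · have := hP.exists_heavy (isInducedP6_of h01 (hadj 0 (by omega)) (hadj 1 (by omega))
      (hadj 2 (by omega)) (hadj 3 (by omega)) (hq₁o 1 (by omega) (by omega)).1
      (hq₁o 2 (by omega) (by omega)).1 (hq₁o 3 (by omega) (by omega)).1
      (hq₁o 4 (by omega) (by omega)).1 (hnadj 0 2 (by omega) (by omega))
      (hnadj 0 3 (by omega) (by omega)) (hnadj 0 4 (by omega) (by omega))
      (hnadj 1 3 (by omega) (by omega)) (hnadj 1 4 (by omega) (by omega))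
      (hnadj 2 4 (by omega) (by omega)))
    simp only [Nat.reduceAdd] at this
    have := (hq₁o 1 (by omega) (by omega)).2
    have := (hq₁o 2 (by omega) (by omega)).2
    have := (hq₁o 3 (by omega) (by omega)).2
    have := hoo 0 3 (by omega) (by omega)
    have := hoo 0 4 (by omega) (by omega)
    have := hoo 1 4 (by omega) (by omega)
    have := hoo 2 4 (by omega) (by omega)
    omega

lemma level_le {L : ℕ} {ℓ : ℕ → ℕ} (hs : ∀ t < L, ℓ (t + 1) ≤ ℓ t + 1) {s t : ℕ} (hst : s ≤ t)
    (ht : t ≤ L) : ℓ t ≤ ℓ s + (t - s) := by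
  induction t, hst using Nat.le_induction with
  | base => omega
  | succ t hst ih =>
    have := ih (by omega)
    have := hs t (by omega)
    omega

/-- Along a path of length `L` whose levels rise from `0` to `5` in steps of at most one, the pairs
at distance two marked by `E` cannot meet all windows of length five. -/
lemma false_of_windows {L : ℕ} {ℓ : ℕ → ℕ} {E : ℕ → Prop} (h0 : ℓ 0 = 0) (hL : ℓ L = 5)
    (hs : ∀ t < L, ℓ (t + 1) ≤ ℓ t + 1)
    (h1 : ∀ t, t + 2 ≤ L → E t → ℓ (t + 2) ≤ ℓ t + 1)
    (h2 : ∀ t, t + 3 ≤ L → E t → E (t + 1) → ℓ (t + 3) ≤ ℓ t + 1)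
    (h3 : ∀ t, t + 4 ≤ L → E t → E (t + 1) → E (t + 2) → ∃ i, (i = 0 ∨ i = 4) ∧
      i ≤ ℓ t ∧ ℓ (t + 4) ≤ i + 1)
    (hw : ∀ t, t + 5 ≤ L → E t ∨ E (t + 3))
    (hc : ∀ s t, s + 3 ≤ t → t + 2 ≤ L → E s → ¬ E t) : False := by
  have up : ∀ s t, s ≤ t → t ≤ L → ℓ t ≤ ℓ s + (t - s) := fun s t => level_le hs
  have run : ∀ t, t ≤ 3 → t + 4 ≤ L → E t → E (t + 1) → E (t + 2) → False := by
    intro t ht htL e1 e2 e3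
    obtain ⟨i, rfl | rfl, hi1, hi2⟩ := h3 t htL e1 e2 e3
    · have := up (t + 4) L htL le_rfl
      rcases hw (t + 3) (by omega) with h | h
      · exact hc t (t + 3) (by omega) (by omega) e1 h
      · exact hc t (t + 6) (by omega) (by omega) e1 h
    · have := up 0 t (by omega) (by omega)
      omega
  have hL5 := up 0 L (by omega) le_rfl
  obtain rfl | hL6 : L = 5 ∨ 6 ≤ L := by omega
  · have := up 2 5 (by omega) le_rfl
    have := up 0 3 (by omega) (by omega)
    rcases hw 0 (by omega) with h | h
    · have := h1 0 (by omega) h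
      simp only [zero_add] at this
      omega
    · have := h1 3 (by omega) h
      simp only [Nat.reduceAdd] at this
      omega
  have c04 := hc 0 4 (by omega) (by omega)
  have hw0 := hw 0 (by omega)
  have hw1 := hw 1 (by omega)
  simp only [Nat.reduceAdd] at hw0 hw1
  obtain rfl | hL7 : L = 6 ∨ 7 ≤ L := by omega
  · have a1 := up 3 6 (by omega) (by omega)
    have a2 := up 0 1 (by omega) (by omega)
    have a3 := up 5 6 (by omega) (by omega)
    have a4 := up 0 3 (by omega) (by omega)
    have b1 := h2 0 (by omega)
    have b2 := h2 3 (by omega)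
    have b3 := h1 1 (by omega)
    have b4 := h1 3 (by omega)
    simp only [Nat.reduceAdd] at b1 b2 b3 b4
    rcases hw0 with e0 | e3
    · rcases hw1 with e1 | e4
      · have := b1 e0 e1
        omega
      · exact c04 e0 e4
    · rcases hw1 with e1 | e4
      · have := b3 e1
        have := b4 e3
        omega
      · have := b2 e3 e4
        omega
  have hw2 := hw 2 (by omega)
  have c05 := hc 0 5 (by omega) (by omega)
  have c15 := hc 1 5 (by omega) (by omega)
  have r0 := run 0 (by omega) (by omega)
  have r1 := run 1 (by omega) (by omega)
  have r2 := run 2 (by omega) (by omega)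
  have r3 := run 3 (by omega) (by omega)
  simp only [Nat.reduceAdd] at hw2 r0 r1 r2 r3
  rcases hw0 with e0 | e3
  · exact r0 e0 (hw1.resolve_right (c04 e0)) (hw2.resolve_right (c05 e0))
  · rcases hw1 with e1 | e4
    · exact r1 e1 (hw2.resolve_right (c15 e1)) e3
    · rcases hw2 with e2 | e5
      · exact r2 e2 e3 e4
      · exact r3 e3 e4 e5

/-- `p 0, …, p 5` is an induced path of `H`. -/
structure IsChainIn (H : SimpleGraph V) (p : ℕ → V) : Prop where
  inj : ∀ i j, i ≤ 5 → j ≤ 5 → p i = p j → i = j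
  adj_iff : ∀ i j, i ≤ 5 → j ≤ 5 → (H.Adj (p i) (p j) ↔ i + 1 = j ∨ j + 1 = i)

/-- `v` is `p i` or a simplicial common neighbour of `p i` and `p (i + 1)`. -/
def AtLevel (H : SimpleGraph V) (p : ℕ → V) (i : ℕ) (v : V) : Prop :=
  i ≤ 5 ∧ v = p i ∨ i < 5 ∧ Middle H (p i) (p (i + 1)) v

namespace IsChainIn

variable {H : SimpleGraph V} {p : ℕ → V}

lemma eq_or_eq_of_adj (hp : IsChainIn H p)
    {i j : ℕ} {v : V} (hi : i < 5) (hv : Middle H (p i) (p (i + 1)) v)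
    (hj : j ≤ 5) (h : H.Adj v (p j)) : j = i ∨ j = i + 1 := by
  by_contra! hne
  have h1 := (hp.adj_iff _ _ hj (by omega)).1
    (hv.1 _ _ h hv.2.1 fun e => hne.1 (hp.inj _ _ hj (by omega) e))
  have h2 := (hp.adj_iff _ _ hj (by omega)).1
    (hv.1 _ _ h hv.2.2 fun e => hne.2 (hp.inj _ _ hj (by omega) e))
  omega

lemma ne_of_middle (hp : IsChainIn H p)
    {i j : ℕ} {v : V} (hi : i < 5) (hv : Middle H (p i) (p (i + 1)) v)
    (hj : j ≤ 5) : v ≠ p j := by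
  rintro rfl
  have h1 := (hp.adj_iff _ _ hj (by omega)).1 hv.2.1
  have h2 := (hp.adj_iff _ _ hj (by omega)).1 hv.2.2
  omega

lemma atLevel_unique (hp : IsChainIn H p)
    {i j : ℕ} {v : V} (hi : AtLevel H p i v) (hj : AtLevel H p j v) :
    i = j := by
  rcases hi with ⟨hi, rfl⟩ | ⟨hi, hv⟩ <;> rcases hj with ⟨hj, e⟩ | ⟨hj, hw⟩
  · exact hp.inj _ _ hi hj e
  · exact (hp.ne_of_middle hj hw hi rfl).elim
  · exact (hp.ne_of_middle hi hv hj e).elim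
  · have h1 := hp.eq_or_eq_of_adj hi hv (by omega) hw.2.1
    have h2 := hp.eq_or_eq_of_adj hj hw (by omega) hv.2.1
    omega

/-- A vertex of the chain adjacent to a middle vertex lies in the same piece. -/
lemma same_piece (hp : IsChainIn H p)
    {i j : ℕ} {u v : V} (hi : i < 5) (hu : Middle H (p i) (p (i + 1)) u)
    (hv : AtLevel H p j v) (h : H.Adj u v) :
    v = p i ∨ v = p (i + 1) ∨ Middle H (p i) (p (i + 1)) v := by
  rcases hv with ⟨hj, rfl⟩ | ⟨hj, hv⟩
  · rcases hp.eq_or_eq_of_adj hi hu hj h with rfl | rfl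
    · exact .inl rfl
    · exact .inr (.inl rfl)
  · have hc := hu.inCommon h
    have h1 := hp.eq_or_eq_of_adj hj hv (by omega)
      (hc.1.resolve_left (hp.ne_of_middle hj hv (by omega)))
    have h2 := hp.eq_or_eq_of_adj hj hv (by omega)
      (hc.2.resolve_left (hp.ne_of_middle hj hv (by omega)))
    obtain rfl : i = j := by omega
    exact .inr (.inr hv)

lemma level_of_adj (hp : IsChainIn H p)
    {i j : ℕ} {u v : V} (hu : AtLevel H p i u) (hv : AtLevel H p j v)
    (h : H.Adj u v) : j ≤ i + 1 ∧ (j = i + 1 → v = p j) := by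
  rcases hu with ⟨hi, rfl⟩ | ⟨hi, hu⟩
  · rcases hv with ⟨hj, rfl⟩ | ⟨hj, hv⟩
    · have := (hp.adj_iff _ _ hi hj).1 h
      exact ⟨by omega, fun _ => rfl⟩
    · have := hp.eq_or_eq_of_adj hj hv hi h.symm
      exact ⟨by omega, fun _ => by omega⟩
  · rcases hp.same_piece hi hu hv h with e | e | e
    · obtain rfl := hp.atLevel_unique hv (.inl ⟨by omega, e⟩)
      exact ⟨by omega, fun _ => e⟩
    · obtain rfl := hp.atLevel_unique hv (.inl ⟨by omega, e⟩)
      exact ⟨by omega, fun _ => e⟩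
    · obtain rfl := hp.atLevel_unique hv (.inr ⟨hi, e⟩)
      exact ⟨by omega, fun _ => by omega⟩

lemma reachable (hp : IsChainIn H p) {G : SimpleGraph V} (hl : SimpliciallyLinked G H) :
    (restrictTo G fun v => ∃ i, AtLevel H p i v).Reachable (p 0) (p 5) := by
  have key : ∀ i ≤ 5, (restrictTo G fun v => ∃ i, AtLevel H p i v).Reachable (p 0) (p i) := by
    intro i
    induction i with
    | zero => exact fun _ => .refl _
    | succ i ih =>
      intro hi
      obtain ⟨l, hl, hr⟩ := hl _ _ ((hp.adj_iff i (i + 1) (by omega) hi).2 (.inl rfl))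
      refine (ih (by omega)).trans (hl.reachable_restrictTo fun r hrl => ?_)
      rcases hr r hrl with rfl | rfl | h
      · exact ⟨i, .inl ⟨by omega, rfl⟩⟩
      · exact ⟨i + 1, .inl ⟨hi, rfl⟩⟩
      · exact ⟨i, .inr ⟨by omega, h⟩⟩
  exact key 5 le_rfl

lemma exists_common (hp : IsChainIn H p)
    [Fintype V] {G : SimpleGraph V} (hcl : IsClosureOf G H) {i j : ℕ} {u v : V}
    (hu : AtLevel H p i u) (hv : AtLevel H p j v) (huv : u ≠ v) (hnuv : ¬ G.Adj u v)
    (hh : Fintype.card V ≤ dg G u + dg G v) :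
    ∃ c k, G.Adj u c ∧ G.Adj v c ∧ AtLevel H p k c := by
  obtain ⟨c, huc, hvc, hc⟩ := hcl.exists_simplicial huv hnuv hh
  have key : ∀ {i : ℕ} {u : V}, i < 5 → Middle H (p i) (p (i + 1)) u → G.Adj u c →
      ∃ k, AtLevel H p k c := by
    intro i u hi hu huc
    obtain ⟨h1 | h1, h2 | h2⟩ := hu.inCommon (hcl.le huc)
    · exact ⟨i, .inl ⟨by omega, h1⟩⟩
    · exact ⟨i, .inl ⟨by omega, h1⟩⟩
    · exact ⟨i + 1, .inl ⟨by omega, h2⟩⟩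
    · exact ⟨i, .inr ⟨hi, hc, h1, h2⟩⟩
  suffices h : ∃ k, AtLevel H p k c from ⟨c, h.choose, huc, hvc, h.choose_spec⟩
  rcases hu with ⟨hi, rfl⟩ | ⟨hi, hu⟩
  · rcases hv with ⟨hj, rfl⟩ | ⟨hj, hv⟩
    · rcases (hp.adj_iff i j hi hj).1 (hcl.heavy _ _ huv hh) with rfl | rfl
      · exact ⟨i, .inr ⟨by omega, hc, (hcl.le huc).symm, (hcl.le hvc).symm⟩⟩
      · exact ⟨j, .inr ⟨by omega, hc, (hcl.le hvc).symm, (hcl.le huc).symm⟩⟩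
    · exact key hj hv hvc
  · exact key hi hu huc

end IsChainIn

/-- A path whose levels rise in steps of at most one meets every intermediate `p m`. -/
lemma exists_eq_of_level {L : ℕ} {ℓ : ℕ → ℕ} {r p : ℕ → V}
    (hs : ∀ t < L, ℓ (t + 1) ≤ ℓ t + 1 ∧ (ℓ (t + 1) = ℓ t + 1 → r (t + 1) = p (ℓ (t + 1))))
    {s t m : ℕ} (hst : s ≤ t) (ht : t ≤ L) (hsm : ℓ s < m) (hmt : m ≤ ℓ t) :
    ∃ u, s < u ∧ u ≤ t ∧ r u = p m := by
  induction t, hst using Nat.le_induction with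
  | base => omega
  | succ t hst ih =>
    by_cases h : m ≤ ℓ t
    · obtain ⟨u, h1, h2, h3⟩ := ih (by omega) h
      exact ⟨u, h1, by omega, h3⟩
    · obtain ⟨h1, h2⟩ := hs t (by omega)
      obtain rfl : m = ℓ (t + 1) := by omega
      exact ⟨t + 1, by omega, le_rfl, h2 (by omega)⟩

lemma IsChainIn.exists_not_outsideLinked [Fintype V] {G H : SimpleGraph V} {p : ℕ → V}
    (hp : IsChainIn H p) (hcl : IsClosureOf G H) (hP : HeavyPaths G) :
    ∃ i, 1 ≤ i ∧ i ≤ 3 ∧ ¬ OutsideLinked H (p i) (p (i + 1)) := by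
  by_contra! hout
  obtain ⟨L, r, hr0, hrL, hr⟩ := exists_isGeodesic (hp.reachable hcl.linked)
  have hlev : ∀ t, ∃ i, t ≤ L → AtLevel H p i (r t) := by
    intro t
    by_cases ht : t ≤ L
    · rcases t with _ | t
      · exact ⟨0, fun _ => .inl ⟨by omega, hr0⟩⟩
      · obtain ⟨i, hi⟩ := (hr.adj t (by omega)).2.2
        exact ⟨i, fun _ => hi⟩
    · exact ⟨0, fun h => (ht h).elim⟩
  choose ℓ hℓ using hlev
  have h0 : ℓ 0 = 0 := hp.atLevel_unique (hℓ 0 (by omega)) (.inl ⟨by omega, hr0⟩)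
  have hL : ℓ L = 5 := hp.atLevel_unique (hℓ L le_rfl) (.inl ⟨le_rfl, hrL⟩)
  have hG : ∀ t < L, G.Adj (r t) (r (t + 1)) := fun t ht => (hr.adj t ht).1
  have hnG : ∀ s t, s + 2 ≤ t → t ≤ L → ¬ G.Adj (r s) (r t) := fun s t hst ht h =>
    hr.not_adj s t hst ht ⟨h, ⟨_, hℓ s (by omega)⟩, ⟨_, hℓ t ht⟩⟩
  have hlip : ∀ s t, s ≤ L → t ≤ L → H.Adj (r s) (r t) →
      ℓ t ≤ ℓ s + 1 ∧ (ℓ t = ℓ s + 1 → r t = p (ℓ t)) := fun s t hs ht h =>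
    hp.level_of_adj (hℓ s hs) (hℓ t ht) h
  have hs : ∀ t < L, ℓ (t + 1) ≤ ℓ t + 1 ∧ (ℓ (t + 1) = ℓ t + 1 → r (t + 1) = p (ℓ (t + 1))) :=
    fun t ht => hlip t (t + 1) (by omega) (by omega) (hcl.le (hG t ht))
  have hfar : ∀ s t, s + 3 ≤ t → t ≤ L → dg G (r s) + dg G (r t) < Fintype.card V := by
    intro s t hst ht
    by_contra! hh
    obtain ⟨c, k, h1, h2, hc⟩ := hp.exists_common hcl (hℓ s (by omega)) (hℓ t ht)
      (hr.ne s t (by omega) ht) (hnG s t (by omega) ht) hh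
    exact hr.no_common s t c hst ht ⟨h1, ⟨_, hℓ s (by omega)⟩, ⟨_, hc⟩⟩
      ⟨h2.symm, ⟨_, hc⟩, ⟨_, hℓ t ht⟩⟩
  set E : ℕ → Prop := fun t => Fintype.card V ≤ dg G (r t) + dg G (r (t + 2)) with hE
  have hA1 : ∀ t, t + 1 ≤ L → H.Adj (r t) (r (t + 1)) := fun t ht => hcl.le (hG t ht)
  have hA2 : ∀ t, t + 2 ≤ L → E t → H.Adj (r t) (r (t + 2)) := fun t ht h =>
    hcl.heavy _ _ (hr.ne _ _ (by omega) ht) h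
  have hA3 : ∀ t, t + 3 ≤ L → E t → E (t + 1) → H.Adj (r t) (r (t + 3)) := fun t ht e1 e2 =>
    hcl.diamond (r (t + 1)) _ (r (t + 2)) _ (hA1 t (by omega)).symm (hA1 _ (by omega))
      (hA2 _ ht e2) (hr.ne _ _ (by omega) ht) (hA2 t (by omega) e1) (hA1 _ (by omega))
  have hA4 : ∀ t, t + 4 ≤ L → E t → E (t + 1) → E (t + 2) → H.Adj (r t) (r (t + 4)) :=
    fun t ht e1 e2 e3 => hcl.diamond (r (t + 2)) _ (r (t + 1)) _ (hA2 t (by omega) e1).symm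
      (hA1 (t + 1) (by omega)).symm (hA2 (t + 2) ht e3) (hr.ne _ _ (by omega) ht)
      (hA1 t (by omega)) (hA3 (t + 1) ht e2 e3)
  refine false_of_windows (E := E) h0 hL (fun t ht => (hs t ht).1)
    (fun t ht e => (hlip _ _ (by omega) ht (hA2 t ht e)).1)
    (fun t ht e1 e2 => (hlip _ _ (by omega) ht (hA3 t ht e1 e2)).1) ?_ ?_ ?_
  · intro t ht e1 e2 e3
    have hA : ∀ a b, a < b → b ≤ 4 → H.Adj (r (t + a)) (r (t + b)) := by
      intro a b hab hb
      obtain h | h | h | h : b = a + 1 ∨ b = a + 2 ∨ b = a + 3 ∨ b = a + 4 := by omega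
      · subst h
        exact hA1 _ (by omega)
      · subst h
        obtain rfl | rfl | rfl : a = 0 ∨ a = 1 ∨ a = 2 := by omega
        exacts [hA2 _ (by omega) e1, hA2 _ (by omega) e2, hA2 _ (by omega) e3]
      · subst h
        obtain rfl | rfl : a = 0 ∨ a = 1 := by omega
        exacts [hA3 _ (by omega) e1 e2, hA3 _ (by omega) e2 e3]
      · obtain rfl : a = 0 := by omega
        subst h
        exact hA4 _ (by omega) e1 e2 e3
    obtain ⟨a, i, ha, hi, hm⟩ : ∃ a i, a ≤ 4 ∧ i < 5 ∧ Middle H (p i) (p (i + 1)) (r (t + a)) := by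
      by_contra! hno
      have hno' : ∀ a ≤ 4, ∃ i ≤ 5, r (t + a) = p i := fun a ha => by
        rcases hℓ (t + a) (by omega) with h | h
        · exact ⟨_, h⟩
        · exact (hno a _ ha h.1 h.2).elim
      obtain ⟨i, hi, ei⟩ := hno' 0 (by omega)
      obtain ⟨j, hj, ej⟩ := hno' 1 (by omega)
      obtain ⟨k, hk, ek⟩ := hno' 2 (by omega)
      have h1 := hA 0 1 (by omega) (by omega)
      have h2 := hA 0 2 (by omega) (by omega)
      have h3 := hA 1 2 (by omega) (by omega)
      rw [ei, ej, hp.adj_iff i j hi hj] at h1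
      rw [ei, ek, hp.adj_iff i k hi hk] at h2
      rw [ej, ek, hp.adj_iff j k hj hk] at h3
      omega
    have hpiece : ∀ b ≤ 4, r (t + b) = p i ∨ r (t + b) = p (i + 1) ∨
        Middle H (p i) (p (i + 1)) (r (t + b)) := by
      intro b hb
      rcases lt_trichotomy a b with h | rfl | h
      · exact hp.same_piece hi hm (hℓ _ (by omega)) (hA a b h hb)
      · exact .inr (.inr hm)
      · exact hp.same_piece hi hm (hℓ _ (by omega)) (hA b a h ha).symm
    have hlv : ∀ b ≤ 4, ℓ (t + b) = i ∨ ℓ (t + b) = i + 1 ∧ r (t + b) = p (i + 1) := by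
      intro b hb
      rcases hpiece b hb with h | h | h
      · exact .inl (hp.atLevel_unique (hℓ _ (by omega)) (.inl ⟨by omega, h⟩))
      · exact .inr ⟨hp.atLevel_unique (hℓ _ (by omega)) (.inl ⟨by omega, h⟩), h⟩
      · exact .inl (hp.atLevel_unique (hℓ _ (by omega)) (.inr ⟨hi, h⟩))
    have hl0 := hlv 0 (by omega)
    have hl4 := hlv 4 (by omega)
    rw [add_zero] at hl0
    by_contra! hcon
    have hi1 : i ≠ 0 := fun h => by have := hcon i (.inl h); omega
    have hi3 : i ≠ 4 := fun h => by have := hcon i (.inr h); omega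
    obtain ⟨x, -, hxt, hx⟩ := exists_eq_of_level (m := i) hs (Nat.zero_le t) (by omega)
      (by omega) (by omega)
    obtain ⟨y, hty, hyL, hy⟩ : ∃ y, t + 4 ≤ y ∧ y ≤ L ∧ r y = p (i + 1) := by
      rcases hl4 with h | h
      · obtain ⟨y, h1, h2, h3⟩ := exists_eq_of_level (m := i + 1) hs ht le_rfl
          (by omega) (by omega)
        exact ⟨y, by omega, h2, h3⟩
      · exact ⟨t + 4, le_rfl, ht, h.2⟩
    have hlx : ℓ x = i := hp.atLevel_unique (hℓ x (by omega)) (.inl ⟨by omega, hx⟩)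
    have hly : ℓ y = i + 1 := hp.atLevel_unique (hℓ y hyL) (.inl ⟨by omega, hy⟩)
    have hmid : ∀ s, x < s → s < y → Middle H (p i) (p (i + 1)) (r s) := by
      intro s hxs hsy
      have h1 : i ≤ ℓ s := by
        by_contra! hlt
        obtain ⟨u, h1, h2, h3⟩ := exists_eq_of_level (m := i) hs hsy.le hyL hlt (by omega)
        exact hr.ne x u (by omega) (by omega) (hx.trans h3.symm)
      have h2 : ℓ s ≤ i := by
        by_contra! hlt
        obtain ⟨u, h1, h2, h3⟩ := exists_eq_of_level (m := i + 1) hs hxs.le (by omega)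
          (by omega) hlt
        exact hr.ne u y (by omega) hyL (h3.trans hy.symm)
      obtain h3 : ℓ s = i := by omega
      rcases h3 ▸ hℓ s (by omega) with h | h
      · exact (hr.ne x s hxs (by omega) (hx.trans h.2.symm)).elim
      · exact h.2
    obtain ⟨z, rfl⟩ : ∃ z, y = z + 1 := ⟨y - 1, by omega⟩
    refine absurd e2 (not_le.2 (not_heavy_of_outsideLinked hcl hP (a := p i) (b := p (i + 1))
      (q₁ := r (x + 1)) (q₂ := r z) ((hp.adj_iff _ _ (by omega) (by omega)).2 (.inl rfl))
      (hout i (by omega) (by omega)) (hmid _ (by omega) (by omega)) (hmid _ (by omega) (by omega))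
      (hmid _ (by omega) (by omega)) (hmid _ (by omega) (by omega)) ?_ ?_ ?_ ?_ ?_ ?_ ?_ ?_ ?_ ?_))
    all_goals try rw [← hx]
    all_goals try rw [← hy]
    · exact (hG x (by omega)).symm
    · exact (hG z (by omega)).symm
    · exact hnG _ _ (by omega) (by omega)
    · exact hnG _ _ (by omega) (by omega)
    · exact hnG _ _ (by omega) (by omega)
    · exact hnG _ _ (by omega) (by omega)
    · exact hfar _ _ (by omega) (by omega)
    · exact hfar _ _ (by omega) (by omega)
    · exact hfar _ _ (by omega) (by omega)
    · rw [add_comm]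
      exact hfar _ _ (by omega) (by omega)
  · intro t ht
    have := hP.exists_heavy (isInducedP6_of (hG t (by omega)) (hG (t + 1) (by omega))
      (hG (t + 2) (by omega)) (hG (t + 3) (by omega)) (hG (t + 4) (by omega))
      (hnG _ _ (by omega) (by omega)) (hnG _ _ (by omega) (by omega))
      (hnG _ _ (by omega) (by omega)) (hnG _ _ (by omega) (by omega))
      (hnG _ _ (by omega) (by omega)) (hnG _ _ (by omega) (by omega))
      (hnG _ _ (by omega) (by omega)) (hnG _ _ (by omega) (by omega))
      (hnG _ _ (by omega) (by omega)) (hnG _ _ (by omega) (by omega)))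
    have := hfar t (t + 3) (by omega) (by omega)
    have := hfar t (t + 4) (by omega) (by omega)
    have := hfar (t + 1) (t + 4) (by omega) (by omega)
    have := hfar (t + 1) (t + 5) (by omega) (by omega)
    have := hfar (t + 2) (t + 5) (by omega) (by omega)
    simp only [hE, Nat.add_assoc, Nat.reduceAdd] at *
    omega
  · intro s t hst ht e1 e2
    have := hfar s t (by omega) (by omega)
    have := hfar (s + 2) (t + 2) (by omega) (by omega)
    simp only [hE] at e1 e2
    omega

lemma dg_eq_degree [Fintype V] (G : SimpleGraph V) [DecidableRel G.Adj] (v : V) :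
    dg G v = G.degree v := by
  rw [dg, Set.ncard_eq_toFinset_card', ← SimpleGraph.neighborFinset_def,
    card_neighborFinset_eq_degree]

lemma ClawOHeavy.clawHeavy [Fintype V] {G : SimpleGraph V} [DecidableRel G.Adj]
    (h : ClawOHeavy G) : ClawHeavy G := by
  intro y a b c ha hb hc hab hac hbc
  by_contra! hno
  simp only [OAdj, not_or, not_and, not_le, dg_eq_degree] at hno
  obtain ⟨⟨h1, h1'⟩, ⟨h2, h2'⟩, h3, h3'⟩ := hno
  obtain ⟨u, v, hu, hv, huv, hn, hd⟩ := h y a b c hab hac hbc ha hb hc h1 h2 h3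
  have := h1' hab
  have := h2' hac
  have := h3' hbc
  have := ha.symm
  have := hb.symm
  have := hc.symm
  simp only [Set.mem_insert_iff, Set.mem_singleton_iff] at hu hv
  rcases hu with rfl | rfl | rfl | rfl <;> rcases hv with rfl | rfl | rfl | rfl <;>
    first | contradiction | omega

lemma P6GammaHeavy.heavyPaths [Fintype V] {G : SimpleGraph V} [DecidableRel G.Adj]
    (h : P6GammaHeavy G gamma3) : HeavyPaths G := by
  intro v hv
  obtain ⟨i, j, hij, hd⟩ := h v hv
  exact ⟨i, j, hij, by rwa [dg_eq_degree, dg_eq_degree]⟩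

lemma IsInducedP6.isChainIn {H : SimpleGraph V} {v : Fin 6 → V} (h : IsInducedP6 H v) :
    IsChainIn H fun n => v (Fin.ofNat 6 n) where
  inj i j hi hj e := by
    have := congrArg Fin.val (h.1 e)
    simp only [Fin.val_ofNat] at this
    omega
  adj_iff i j hi hj := by
    rw [h.2]
    simp only [Fin.val_ofNat]
    omega

end

/-- Every 2-connected claw-o-heavy and `P₆`-`γ3`-heavy graph is hamiltonian. -/
theorem stmt_3 {V : Type*} [Fintype V] [DecidableEq V] (G : SimpleGraph V) [DecidableRel G.Adj]
    (h2conn : TwoConnected G) (hclaw : ClawOHeavy G)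
    (hP6 : P6GammaHeavy G gamma3) :
    G.IsHamiltonian := by
  by_contra hG
  obtain ⟨H, hcl⟩ := exists_isClosureOf h2conn.1 (fun h => hG (h.isHamiltonian h2conn.1))
    hclaw.clawHeavy
  obtain ⟨u, v, a, a', b, b', h, s, α, β, R, he⟩ := h2conn.exists_isEar hcl.le hcl.not_ham
  obtain ⟨p, hp, h1, h2, h3⟩ := he.exists_isInducedP6 hcl.claw hcl.diamond
  obtain ⟨i, hi1, hi3, hi⟩ := hp.isChainIn.exists_not_outsideLinked hcl hP6.heavyPaths
  obtain rfl | rfl | rfl : i = 1 ∨ i = 2 ∨ i = 3 := by omega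
  exacts [hi h1, hi h2, hi h3]
end

section
/- Let γ be a symmetrical graph (possibly with loops) on I = {1,2,3,4,5,6}. If every 2-connected claw-o-heavy and P6-γ-heavy graph is hamiltonian, then γ is a subgraph of γ1, of γ2, or of γ3, where E(γ1) = {14,15,16,24,25,26,34,35,36}, E(γ2) = {11,12,14,15,16,25,26,36,56,66}, and E(γ3) = {13,14,15,25,26,36,46}. -/
namespace SimpleGraph

section TwoConnected

variable {V : Type*} [Fintype V] {G : SimpleGraph V}

/-- A graph with a ranking of its vertices in which every vertex other than `s` has a neighbour of
lower rank and every vertex other than `t` has a neighbour of higher rank is 2-connected, provided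
that `s` and `t` are adjacent. -/
theorem twoConnected_of_rank (hcard : 3 ≤ Fintype.card V) (r : V → ℕ) (s t : V) (hst : G.Adj s t)
    (hlow : ∀ v, v ≠ s → ∃ u, G.Adj v u ∧ r u < r v)
    (hhigh : ∀ v, v ≠ t → ∃ u, G.Adj v u ∧ r v < r u) : TwoConnected G := by
  classical
  refine ⟨hcard, fun v => ?_⟩
  have down : ∀ k, ∀ u (hu : u ≠ v), r u = k → r u ≤ r v → ∃ hs : s ≠ v,
      (G.induce ({v}ᶜ : Set V)).Reachable ⟨u, hu⟩ ⟨s, hs⟩ := by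
    intro k
    induction k using Nat.strong_induction_on with
    | _ k ih =>
      intro u hu hk hle
      by_cases hus : u = s
      · subst hus
        exact ⟨hu, Reachable.refl _⟩
      · obtain ⟨x, hx, hlt⟩ := hlow u hus
        have hxv : x ≠ v := by rintro rfl; omega
        obtain ⟨hs, hr⟩ := ih (r x) (by omega) x hxv rfl (by omega)
        exact ⟨hs, Reachable.trans (Adj.reachable (by simpa using hx)) hr⟩
  obtain ⟨M, hM⟩ : ∃ M, ∀ u, r u ≤ M :=
    ⟨Finset.univ.sup r, fun u => Finset.le_sup (f := r) (Finset.mem_univ u)⟩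
  have up : ∀ k, ∀ u (hu : u ≠ v), M - r u = k → r v ≤ r u → ∃ ht : t ≠ v,
      (G.induce ({v}ᶜ : Set V)).Reachable ⟨u, hu⟩ ⟨t, ht⟩ := by
    intro k
    induction k using Nat.strong_induction_on with
    | _ k ih =>
      intro u hu hk hle
      by_cases hut : u = t
      · subst hut
        exact ⟨hu, Reachable.refl _⟩
      · obtain ⟨x, hx, hlt⟩ := hhigh u hut
        have hxv : x ≠ v := by rintro rfl; omega
        have := hM x
        obtain ⟨ht, hr⟩ := ih (M - r x) (by omega) x hxv rfl (by omega)
        exact ⟨ht, Reachable.trans (Adj.reachable (by simpa using hx)) hr⟩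
  obtain ⟨c, hc⟩ : ∃ c : ({v}ᶜ : Set V), ∀ u, (G.induce ({v}ᶜ : Set V)).Reachable u c := by
    by_cases hs : s = v
    · refine ⟨⟨t, fun h => hst.ne (hs.trans h.symm)⟩, fun ⟨u, hu⟩ => ?_⟩
      rcases le_total (r u) (r v) with h | h
      · exact absurd hs (down _ u hu rfl h).1
      · exact (up _ u hu rfl h).2
    · refine ⟨⟨s, hs⟩, fun ⟨u, hu⟩ => ?_⟩
      rcases le_total (r u) (r v) with h | h
      · exact (down _ u hu rfl h).2
      · obtain ⟨ht, hr⟩ := up _ u hu rfl h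
        exact hr.trans (Adj.reachable (by simpa using hst.symm))
  exact (connected_iff _).2 ⟨fun x y => (hc x).trans (hc y).symm, ⟨c⟩⟩

end TwoConnected

section Hamiltonian

variable {V : Type*} [DecidableEq V] {G : SimpleGraph V}

/-- Deleting a vertex from a Hamiltonian cycle leaves a connected graph. -/
theorem Walk.IsHamiltonianCycle.exists_edge_crossing {u : V} {p : G.Walk u u}
    (hp : p.IsHamiltonianCycle) {S : Set V} {a x t : V} (ha : a ∉ S) (hx : x ∈ S) (ht : t ∉ S)
    (hta : t ≠ a) : ∃ y ∈ S, ∃ z, z ∉ S ∧ z ≠ a ∧ s(y, z) ∈ p.edges := by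
  have hcyc := hp.isCycle.rotate (hp.mem_support a)
  have hsupp : ∀ v, v ∈ (p.rotate a (hp.mem_support a)).support := fun v => by
    simpa using hp.mem_support v
  have hedges : ∀ e, e ∈ (p.rotate a (hp.mem_support a)).edges → e ∈ p.edges := fun e he =>
    (p.rotate_edges a (hp.mem_support a)).mem_iff.1 he
  generalize p.rotate a (hp.mem_support a) = q at hcyc hsupp hedges
  cases q with
  | nil => exact absurd rfl hcyc.ne_nil
  | @cons _ b _ hab r =>
    have hr := ((cons_isCycle_iff _ _).1 hcyc).1.reverse
    have hrs : ∀ v, v ∈ r.reverse.support := fun v => by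
      have := hsupp v
      simp only [support_cons, List.mem_cons] at this
      rcases this with rfl | h <;> simp_all
    have hre : ∀ e ∈ r.reverse.edges, e ∈ p.edges := fun e he => hedges e (by simp_all)
    generalize r.reverse = r' at hr hrs hre
    cases r' with
    | nil => exact absurd hab (G.irrefl)
    | @cons _ c _ hac w =>
      obtain ⟨-, haw⟩ := (cons_isPath_iff _ _).1 hr
      have hw : ∀ v, v ≠ a → v ∈ w.support := fun v hv => by
        have := hrs v
        simp only [support_cons, List.mem_cons] at this
        exact this.resolve_left hv
      have hxw := hw x (fun h => ha (h ▸ hx))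
      have htw := hw t hta
      obtain ⟨d, hd, h1, h2⟩ := ((w.takeUntil x hxw).reverse.append
        (w.takeUntil t htw)).exists_boundary_dart S hx ht
      have hdw : d.edge ∈ w.edges := by
        have : d.edge ∈ ((w.takeUntil x hxw).reverse.append (w.takeUntil t htw)).edges :=
          List.mem_map_of_mem hd
        rw [edges_append, List.mem_append, edges_reverse, List.mem_reverse] at this
        exact this.elim (fun h => w.edges_takeUntil_subset_edges hxw h)
          (fun h => w.edges_takeUntil_subset_edges htw h)
      refine ⟨d.fst, h1, d.snd, h2, ?_, hre _ (by simp only [edges_cons, List.mem_cons]; exact .inr hdw)⟩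
      intro h
      exact haw (h ▸ w.snd_mem_support_of_mem_edges hdw)

theorem Walk.IsHamiltonianCycle.exists_mem_edges_iff {u : V} {p : G.Walk u u}
    (hp : p.IsHamiltonianCycle) (v : V) :
    ∃ x y, x ≠ y ∧ ∀ z, s(v, z) ∈ p.edges ↔ z = x ∨ z = y := by
  have h := hp.isCycle.ncard_neighborSet_toSubgraph_eq_two (hp.mem_support v)
  obtain ⟨x, y, hxy, h⟩ := Set.ncard_eq_two.1 h
  refine ⟨x, y, hxy, fun z => ?_⟩
  have := Set.ext_iff.1 h z
  simpa [Subgraph.mem_neighborSet, ← Subgraph.mem_edgeSet] using this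

/-- Let `b₁, b₂, b₃` be such that `b₂` and `b₃` lie on triangles `aᵢbᵢcᵢ` with `cᵢ` of degree two,
and `b₁` belongs to a set `S` whose only other attachment is `a`. If the remaining edges at the
`bᵢ` join these three vertices to each other, the graph is not hamiltonian. -/
theorem not_isHamiltonian_of_three_connectors [Fintype V] (S : Set V) (a x b₁ a₂ b₂ c₂ a₃ b₃ c₃ : V)
    (ha : a ∉ S) (hb₁ : b₁ ∈ S) (hx : x ∈ S) (hxb : x ≠ b₁) (hb₂ : b₂ ∉ S) (hb₃ : b₃ ∉ S)
    (h₂₃ : b₂ ≠ b₃) (ha₂ : a₂ ≠ b₂) (ha₃ : a₃ ≠ b₃) (hab₂ : a ≠ b₂)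
    (hac₂ : a₂ ≠ c₂) (hbc₂ : b₂ ≠ c₂) (hac₃ : a₃ ≠ c₃) (hbc₃ : b₃ ≠ c₃)
    (hb₃a₂ : b₃ ≠ a₂) (hb₃c₂ : b₃ ≠ c₂) (hb₂a₃ : b₂ ≠ a₃) (hb₂c₃ : b₂ ≠ c₃)
    (hb₁c₂ : b₁ ≠ c₂) (hb₁c₃ : b₁ ≠ c₃)
    (hS : ∀ v ∈ S, v ≠ b₁ → ∀ z, G.Adj v z → z ∈ S ∨ z = a)
    (hNb₁ : ∀ z, G.Adj b₁ z → z ∈ S ∨ z = a ∨ z = b₂ ∨ z = b₃)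
    (hNc₂ : ∀ z, G.Adj c₂ z → z = a₂ ∨ z = b₂)
    (hNb₂ : ∀ z, G.Adj b₂ z → z = a₂ ∨ z = c₂ ∨ z = b₁ ∨ z = b₃)
    (hNc₃ : ∀ z, G.Adj c₃ z → z = a₃ ∨ z = b₃)
    (hNb₃ : ∀ z, G.Adj b₃ z → z = a₃ ∨ z = c₃ ∨ z = b₁ ∨ z = b₂) : ¬ G.IsHamiltonian := by
  intro hham
  obtain ⟨u, p, hp⟩ := hham (by
    have : Nontrivial V := ⟨b₂, b₃, h₂₃⟩
    exact Fintype.one_lt_card.ne')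
  have hG : ∀ {y z}, s(y, z) ∈ p.edges → G.Adj y z := fun h => p.adj_of_mem_edges h
  have hsymm : ∀ {y z}, s(y, z) ∈ p.edges → s(z, y) ∈ p.edges := fun h => by rwa [Sym2.eq_swap]
  -- each of `b₂`, `b₃` has exactly one cycle edge towards the other two `bᵢ`
  have key : ∀ {a' b c b' : V}, a' ≠ b → a' ≠ c → b ≠ c → b' ≠ a' → b' ≠ c → b' ≠ b → b₁ ≠ c →
      (∀ z, G.Adj c z → z = a' ∨ z = b) → (∀ z, G.Adj b z → z = a' ∨ z = c ∨ z = b₁ ∨ z = b') →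
      b' ≠ b₁ → ((s(b, b₁) ∈ p.edges ∧ s(b, b') ∉ p.edges) ∨
        (s(b, b₁) ∉ p.edges ∧ s(b, b') ∈ p.edges)) := by
    intro a' b c b' hab hac hbc hba hbc' hbb hb₁c hNc hNb hb'b₁
    have hcb : s(c, b) ∈ p.edges := by
      obtain ⟨y, z, hyz, h⟩ := hp.exists_mem_edges_iff c
      have h1 := hNc y (hG ((h y).2 (.inl rfl)))
      have h2 := hNc z (hG ((h z).2 (.inr rfl)))
      exact (h b).2 (by grind)
    obtain ⟨y, z, hyz, h⟩ := hp.exists_mem_edges_iff b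
    have h1 := hNb y (hG ((h y).2 (.inl rfl)))
    have h2 := hNb z (hG ((h z).2 (.inr rfl)))
    have h3 := (h c).1 (hsymm hcb)
    have h4 : s(b, a') ∉ p.edges := by
      intro hba'
      have h5 := (h a').1 hba'
      obtain ⟨v, hv, w, hw, hwa, hvw⟩ := hp.exists_edge_crossing (S := {b, c}) (a := a') (x := b)
        (t := b') (by simp [hab, hac]) (by simp) (by simp [hbb, hbc']) hba
      simp only [Set.mem_insert_iff, Set.mem_singleton_iff] at hv hw
      rcases hv with rfl | rfl
      · have := (h w).1 hvw
        grind
      · have := hNc w (hG hvw)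
        grind
    rw [h, h]
    rw [h] at h4
    grind
  have hb₂₁ : b₂ ≠ b₁ := fun h => hb₂ (h ▸ hb₁)
  have hb₃₁ : b₃ ≠ b₁ := fun h => hb₃ (h ▸ hb₁)
  have k₂ := key ha₂ hac₂ hbc₂ hb₃a₂ hb₃c₂ h₂₃.symm hb₁c₂ hNc₂ hNb₂ hb₃₁
  have k₃ := key ha₃ hac₃ hbc₃ hb₂a₃ hb₂c₃ h₂₃ hb₁c₃ hNc₃ hNb₃ hb₂₁
  have hswap : s(b₃, b₂) ∈ p.edges ↔ s(b₂, b₃) ∈ p.edges := ⟨hsymm, hsymm⟩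
  by_cases h : s(b₂, b₁) ∈ p.edges
  · have h₂ := hsymm h
    have h₃ : s(b₁, b₃) ∈ p.edges := hsymm (by tauto)
    obtain ⟨v, hv, w, hw, hwa, hvw⟩ := hp.exists_edge_crossing (S := S \ {b₁}) (a := a) (x := x)
      (t := b₂) (by simp [ha]) ⟨hx, hxb⟩ (by simp [hb₂]) hab₂.symm
    have hwS := (hS v hv.1 hv.2 w (hG hvw)).resolve_right hwa
    have hwb : w = b₁ := by
      by_contra hne
      exact hw ⟨hwS, hne⟩
    subst hwb
    obtain ⟨y, z, hyz, h'⟩ := hp.exists_mem_edges_iff w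
    have e1 := (h' _).1 h₂
    have e2 := (h' _).1 h₃
    have e3 := (h' _).1 (hsymm hvw)
    have : v ≠ b₂ := fun e => hb₂ (e ▸ hv.1)
    have : v ≠ b₃ := fun e => hb₃ (e ▸ hv.1)
    grind
  · obtain ⟨v, hv, w, hw, hwa, hvw⟩ := hp.exists_edge_crossing (S := S) (a := a) (x := x)
      (t := b₂) ha hx hb₂ hab₂.symm
    by_cases hvb : v = b₁
    · subst hvb
      rcases hNb₁ w (hG hvw) with h' | h' | rfl | rfl
      · exact hw h'
      · exact hwa h'
      · exact h (hsymm hvw)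
      · have := hsymm hvw
        tauto
    · exact (hS v hv hvb w (hG hvw)).elim hw hwa

end Hamiltonian

section CliqueBlowUp

variable {ι : Type*} (B : SimpleGraph ι) (w : ι → ℕ)

/-- The graph obtained from `B` by replacing each vertex `i` by a clique on `w i` vertices. -/
def cliqueBlowUp : SimpleGraph (Σ i, Fin (w i)) where
  Adj u v := u ≠ v ∧ (u.1 = v.1 ∨ B.Adj u.1 v.1)
  symm := ⟨fun _ _ h => ⟨h.1.symm, h.2.imp Eq.symm Adj.symm⟩⟩
  loopless := ⟨fun _ h => h.1 rfl⟩

variable {B w} in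
theorem cliqueBlowUp_adj {u v : Σ i, Fin (w i)} :
    (cliqueBlowUp B w).Adj u v ↔ u ≠ v ∧ (u.1 = v.1 ∨ B.Adj u.1 v.1) := Iff.rfl

variable [DecidableEq ι]

instance [DecidableRel B.Adj] : DecidableRel (cliqueBlowUp B w).Adj := fun u v =>
  inferInstanceAs (Decidable (u ≠ v ∧ (u.1 = v.1 ∨ B.Adj u.1 v.1)))

variable {B w} in
theorem not_isHamiltonian_cliqueBlowUp [Fintype ι] (a x b₁ a₂ b₂ c₂ a₃ b₃ c₃ : ι)
    (hnodup : [a, x, b₁, b₂, c₂, b₃, c₃].Nodup) (ha₂ : a₂ ∉ [b₂, c₂, b₃])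
    (ha₃ : a₃ ∉ [b₃, c₃, b₂]) (hx : 0 < w x)
    (hw : ∀ i ∈ [a, b₁, a₂, b₂, c₂, a₃, b₃, c₃], w i = 1)
    (hNx : ∀ i, B.Adj x i → i = b₁ ∨ i = a)
    (hNb₁ : ∀ i, B.Adj b₁ i → i = x ∨ i = a ∨ i = b₂ ∨ i = b₃)
    (hNc₂ : ∀ i, B.Adj c₂ i → i = a₂ ∨ i = b₂)
    (hNb₂ : ∀ i, B.Adj b₂ i → i = a₂ ∨ i = c₂ ∨ i = b₁ ∨ i = b₃)
    (hNc₃ : ∀ i, B.Adj c₃ i → i = a₃ ∨ i = b₃)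
    (hNb₃ : ∀ i, B.Adj b₃ i → i = a₃ ∨ i = c₃ ∨ i = b₁ ∨ i = b₂) :
    ¬ (cliqueBlowUp B w).IsHamiltonian := by
  simp only [List.mem_cons, List.not_mem_nil, or_false, forall_eq_or_imp, forall_eq, not_or,
    List.nodup_cons, not_false_eq_true, List.nodup_nil, and_true] at hw hnodup ha₂ ha₃
  obtain ⟨wa, wb₁, wa₂, wb₂, wc₂, wa₃, wb₃, wc₃⟩ := hw
  have fst_ne : ∀ {i j : ι} {k : Fin (w i)} {l : Fin (w j)}, i ≠ j →
      (⟨i, k⟩ : Σ i, Fin (w i)) ≠ ⟨j, l⟩ := fun h e => h (congrArg Sigma.fst e)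
  have single : ∀ {i : ι} (hi : w i = 1) {z : Σ i, Fin (w i)}, z.1 = i ↔
      z = ⟨i, ⟨0, hi ▸ one_pos⟩⟩ := by
    rintro i hi ⟨j, k⟩
    refine ⟨?_, fun e => congrArg Sigma.fst e⟩
    rintro rfl
    have hj : w j = 1 := hi
    refine Sigma.ext rfl (heq_of_eq (Fin.ext ?_))
    have := k.isLt
    simp only at this ⊢
    omega
  have nbr : ∀ {i : ι} (hi : w i = 1) {z : Σ i, Fin (w i)},
      (cliqueBlowUp B w).Adj ⟨i, ⟨0, hi ▸ one_pos⟩⟩ z → B.Adj i z.1 := fun hi z hz =>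
    hz.2.resolve_left fun e => hz.1 ((single hi).1 e.symm).symm
  refine not_isHamiltonian_of_three_connectors {v | v.1 = x ∨ v.1 = b₁}
    ⟨a, ⟨0, wa ▸ one_pos⟩⟩ ⟨x, ⟨0, hx⟩⟩ ⟨b₁, ⟨0, wb₁ ▸ one_pos⟩⟩ ⟨a₂, ⟨0, wa₂ ▸ one_pos⟩⟩
    ⟨b₂, ⟨0, wb₂ ▸ one_pos⟩⟩ ⟨c₂, ⟨0, wc₂ ▸ one_pos⟩⟩ ⟨a₃, ⟨0, wa₃ ▸ one_pos⟩⟩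
    ⟨b₃, ⟨0, wb₃ ▸ one_pos⟩⟩ ⟨c₃, ⟨0, wc₃ ▸ one_pos⟩⟩
    ?_ ?_ ?_ (fst_ne ?_) ?_ ?_ (fst_ne ?_) (fst_ne ?_) (fst_ne ?_) (fst_ne ?_) (fst_ne ?_)
    (fst_ne ?_) (fst_ne ?_) (fst_ne ?_) (fst_ne ?_) (fst_ne ?_) (fst_ne ?_) (fst_ne ?_) (fst_ne ?_)
    (fst_ne ?_) ?_ ?_ ?_ ?_ ?_ ?_
  case refine_21 =>
    intro v hv hvb z hz
    rw [Ne, ← single wb₁] at hvb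
    have hvx : v.1 = x := hv.resolve_right hvb
    rw [← single wa]
    rcases hz.2 with e | e
    · exact .inl (.inl (e ▸ hvx))
    · rw [hvx] at e
      exact (hNx _ e).imp .inr id
  case refine_22 =>
    intro z hz
    rw [← single wa, ← single wb₂, ← single wb₃]
    exact (hNb₁ _ (nbr wb₁ hz)).imp .inl id
  case refine_23 =>
    intro z hz
    rw [← single wa₂, ← single wb₂]
    exact hNc₂ _ (nbr wc₂ hz)
  case refine_24 =>
    intro z hz
    rw [← single wa₂, ← single wc₂, ← single wb₁, ← single wb₃]
    exact hNb₂ _ (nbr wb₂ hz)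
  case refine_25 =>
    intro z hz
    rw [← single wa₃, ← single wb₃]
    exact hNc₃ _ (nbr wc₃ hz)
  case refine_26 =>
    intro z hz
    rw [← single wa₃, ← single wc₃, ← single wb₁, ← single wb₂]
    exact hNb₃ _ (nbr wb₃ hz)
  all_goals grind

variable [DecidableRel B.Adj]

/-- The total weight of the closed neighbourhood of `i` in `B`. -/
def closedWeight [Fintype ι] (i : ι) : ℕ := ∑ j, if i = j ∨ B.Adj i j then w j else 0

variable [Fintype ι]

theorem degree_cliqueBlowUp_add_one (v : Σ i, Fin (w i)) :
    (cliqueBlowUp B w).degree v + 1 = closedWeight B w v.1 := by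
  have h : insert v ((cliqueBlowUp B w).neighborFinset v) =
      (Finset.univ.filter fun j => v.1 = j ∨ B.Adj v.1 j).sigma fun _ => Finset.univ := by
    ext u
    simp only [Finset.mem_insert, mem_neighborFinset, cliqueBlowUp_adj, Finset.mem_sigma,
      Finset.mem_filter, Finset.mem_univ, true_and, and_true]
    by_cases hu : u = v
    · simp [hu]
    · simp [hu, Ne.symm hu]
  rw [← card_neighborFinset_eq_degree, ← Finset.card_insert_of_notMem (a := v) (by simp), h,
    Finset.card_sigma]
  simp [closedWeight, Finset.sum_filter]

/-- Vertices in the classes `i` and `j` of the blow-up have degree sum at least its order. -/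
def IsHeavyPair (i j : ι) : Prop := ∑ k, w k + 2 ≤ closedWeight B w i + closedWeight B w j

instance (i j : ι) : Decidable (IsHeavyPair B w i j) := inferInstanceAs (Decidable (_ ≤ _))

variable {B w}

theorem IsHeavyPair.card_le {u v : Σ i, Fin (w i)} (h : IsHeavyPair B w u.1 v.1) :
    Fintype.card (Σ i, Fin (w i)) ≤
      (cliqueBlowUp B w).degree u + (cliqueBlowUp B w).degree v := by
  have hu := degree_cliqueBlowUp_add_one B w u
  have hv := degree_cliqueBlowUp_add_one B w v
  simp only [IsHeavyPair] at h
  simp only [Fintype.card_sigma, Fintype.card_fin]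
  omega

theorem clawOHeavy_cliqueBlowUp
    (h : ∀ i j, B.Adj i j → ∀ k, B.Adj i k → ¬ (j = k ∨ B.Adj j k) → ∀ l, B.Adj i l →
      ¬ (j = l ∨ B.Adj j l) → ¬ (k = l ∨ B.Adj k l) →
      IsHeavyPair B w j k ∨ IsHeavyPair B w j l ∨ IsHeavyPair B w k l) :
    ClawOHeavy (cliqueBlowUp B w) := by
  intro a b₁ b₂ b₃ h₁₂ h₁₃ h₂₃ ha₁ ha₂ ha₃ n₁₂ n₁₃ n₂₃
  have m₁₂ : ¬ (b₁.1 = b₂.1 ∨ B.Adj b₁.1 b₂.1) := fun e => n₁₂ ⟨h₁₂, e⟩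
  have m₁₃ : ¬ (b₁.1 = b₃.1 ∨ B.Adj b₁.1 b₃.1) := fun e => n₁₃ ⟨h₁₃, e⟩
  have m₂₃ : ¬ (b₂.1 = b₃.1 ∨ B.Adj b₂.1 b₃.1) := fun e => n₂₃ ⟨h₂₃, e⟩
  have adj : ∀ {b c : Σ i, Fin (w i)}, (cliqueBlowUp B w).Adj a b → (cliqueBlowUp B w).Adj a c →
      ¬ (b.1 = c.1 ∨ B.Adj b.1 c.1) → B.Adj a.1 b.1 := by
    intro b c hb hc hbc
    refine hb.2.resolve_left fun e => hbc ?_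
    rw [← e]
    exact hc.2
  rcases h _ _ (adj ha₁ ha₂ m₁₂) _ (adj ha₂ ha₃ m₂₃) m₁₂ _
    (adj ha₃ ha₁ (fun e => m₁₃ (e.imp Eq.symm Adj.symm))) m₁₃ m₂₃ with h | h | h
  · exact ⟨b₁, b₂, by simp, by simp, h₁₂, n₁₂, h.card_le⟩
  · exact ⟨b₁, b₃, by simp, by simp, h₁₃, n₁₃, h.card_le⟩
  · exact ⟨b₂, b₃, by simp, by simp, h₂₃, n₂₃, h.card_le⟩

/-- Every induced `P₆` of the blow-up has a pair of vertices at positions in `L`, up to reversal,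
with large degree sum. The condition is stated so that it can be decided by backtracking. -/
def P6HeavyOn (B : SimpleGraph ι) [DecidableRel B.Adj] (w : ι → ℕ) (L : List (Fin 6 × Fin 6)) :
    Prop :=
  ∀ a b, B.Adj a b → ∀ c, B.Adj b c → ¬ (a = c ∨ B.Adj a c) →
    ∀ d, B.Adj c d → ¬ (a = d ∨ B.Adj a d) → ¬ (b = d ∨ B.Adj b d) →
    ∀ e, B.Adj d e → ¬ (a = e ∨ B.Adj a e) → ¬ (b = e ∨ B.Adj b e) → ¬ (c = e ∨ B.Adj c e) →
    ∀ f, B.Adj e f → ¬ (a = f ∨ B.Adj a f) → ¬ (b = f ∨ B.Adj b f) → ¬ (c = f ∨ B.Adj c f) →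
      ¬ (d = f ∨ B.Adj d f) →
    ∃ q ∈ L, IsHeavyPair B w (![a, b, c, d, e, f] q.1) (![a, b, c, d, e, f] q.2) ∨
      IsHeavyPair B w (![a, b, c, d, e, f] q.1.rev) (![a, b, c, d, e, f] q.2.rev)

instance (L : List (Fin 6 × Fin 6)) : Decidable (P6HeavyOn B w L) := by
  unfold P6HeavyOn
  infer_instance

theorem P6HeavyOn.p6GammaHeavy {L : List (Fin 6 × Fin 6)} (h : P6HeavyOn B w L)
    {γ : Set (Sym2 (Fin 6))} (hsym : SymmetricalGamma γ) (hL : ∀ q ∈ L, s(q.1, q.2) ∈ γ) :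
    P6GammaHeavy (cliqueBlowUp B w) γ := by
  rintro v ⟨hinj, hv⟩
  have near : ∀ i j, i ≠ j → (((v i).1 = (v j).1 ∨ B.Adj (v i).1 (v j).1) ↔
      (i.val + 1 = j.val ∨ j.val + 1 = i.val)) := fun i j hij => by
    rw [← hv i j, cliqueBlowUp_adj, and_iff_right (hinj.ne hij)]
  have far : ∀ i j : Fin 6, i.val + 2 ≤ j.val →
      ¬ ((v i).1 = (v j).1 ∨ B.Adj (v i).1 (v j).1) := fun i j hij e => by
    have := (near i j (by rintro rfl; omega)).1 e
    omega
  have next : ∀ i j k : Fin 6, i.val + 1 = j.val →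
      (k.val + 1 = i.val ∨ k.val = j.val + 1) → B.Adj (v i).1 (v j).1 := by
    intro i j k hij hk
    refine ((near i j (by rintro rfl; omega)).2 (.inl hij)).resolve_left fun e => ?_
    rcases hk with hk | hk
    · refine far k j (by omega) ?_
      rw [← e]
      exact (near k i (by rintro rfl; omega)).2 (.inl hk)
    · refine far i k (by omega) ?_
      rw [e]
      exact (near j k (by rintro rfl; omega)).2 (.inl hk.symm)
  obtain ⟨q, hq, hheavy⟩ := h _ _ (next 0 1 2 rfl (.inr rfl)) _ (next 1 2 0 rfl (.inl rfl))
    (far 0 2 (by decide)) _ (next 2 3 1 rfl (.inl rfl)) (far 0 3 (by decide)) (far 1 3 (by decide))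
    _ (next 3 4 2 rfl (.inl rfl)) (far 0 4 (by decide)) (far 1 4 (by decide)) (far 2 4 (by decide))
    _ (next 4 5 3 rfl (.inl rfl)) (far 0 5 (by decide)) (far 1 5 (by decide)) (far 2 5 (by decide))
    (far 3 5 (by decide))
  have hvec : ![(v 0).1, (v 1).1, (v 2).1, (v 3).1, (v 4).1, (v 5).1] = fun i => (v i).1 := by
    ext i
    fin_cases i <;> rfl
  rw [hvec] at hheavy
  rcases hheavy with hh | hh
  · exact ⟨q.1, q.2, hL q hq, hh.card_le⟩
  · exact ⟨q.1.rev, q.2.rev, (hsym s(q.1, q.2)).1 (hL q hq), hh.card_le⟩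

theorem twoConnected_cliqueBlowUp {N : ℕ} {B : SimpleGraph (Fin (N + 3))} [DecidableRel B.Adj]
    {w : Fin (N + 3) → ℕ} (hw : ∀ i, 0 < w i) (h₀ : w 0 = 1) (h₁ : w (Fin.last _) = 1)
    (hadj : B.Adj 0 (Fin.last _)) (hlow : ∀ i, i ≠ 0 → ∃ j < i, B.Adj i j)
    (hhigh : ∀ i, i ≠ Fin.last _ → ∃ j > i, B.Adj i j) : TwoConnected (cliqueBlowUp B w) := by
  have uniq : ∀ {i} (hi : w i = 1) (v : Σ i, Fin (w i)), v ≠ ⟨i, ⟨0, hw i⟩⟩ → v.1 ≠ i := by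
    rintro i hi ⟨j, k⟩ hv rfl
    have hj : w j = 1 := hi
    refine hv (Sigma.ext rfl (heq_of_eq (Fin.ext ?_)))
    have := k.isLt
    simp only at this ⊢
    omega
  have lift : ∀ {v : Σ i, Fin (w i)} {j}, B.Adj v.1 j →
      (cliqueBlowUp B w).Adj v ⟨j, ⟨0, hw j⟩⟩ := fun h => ⟨fun e => h.ne (congrArg Sigma.fst e), .inr h⟩
  refine twoConnected_of_rank ?_ (fun v => v.1.val) ⟨0, ⟨0, hw 0⟩⟩ ⟨Fin.last _, ⟨0, hw _⟩⟩
    (lift hadj) (fun v hv => ?_) (fun v hv => ?_)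
  · rw [Fintype.card_sigma]
    calc 3 ≤ ∑ _i : Fin (N + 3), 1 := by simp
      _ ≤ _ := Finset.sum_le_sum fun i _ => by simpa [Nat.one_le_iff_ne_zero] using (hw i).ne'
  · obtain ⟨j, hj, hB⟩ := hlow v.1 (uniq h₀ v hv)
    exact ⟨_, lift hB, hj⟩
  · obtain ⟨j, hj, hB⟩ := hhigh v.1 (uniq h₁ v hv)
    exact ⟨_, lift hB, hj⟩

end CliqueBlowUp

end SimpleGraph

section Patterns

open SimpleGraph

/-- The graph on `Fin N` with the given list of edges. -/
def edgeListGraph {N : ℕ} (E : List (Fin N × Fin N)) : SimpleGraph (Fin N) :=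
  fromRel fun i j => (i, j) ∈ E

instance {N : ℕ} (E : List (Fin N × Fin N)) : DecidableRel (edgeListGraph E).Adj :=
  inferInstanceAs (DecidableRel (fromRel fun i j => (i, j) ∈ E).Adj)

/-- Two triangles `a₁a₂a₃` and `b₁b₂b₃` joined by three triangles `aᵢbᵢcᵢ`, with a further vertex
adjacent to all `aᵢ`. The vertices are listed as `c₁, a₁, z, a₂, a₃, c₂, c₃, b₂, b₃, b₁`. -/
def joinedTriangles : SimpleGraph (Fin 10) :=
  edgeListGraph [(0, 1), (0, 9), (1, 9), (3, 5), (3, 7), (5, 7), (4, 6), (4, 8), (6, 8),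
    (7, 8), (7, 9), (8, 9), (1, 2), (2, 3), (2, 4), (1, 3), (1, 4), (3, 4)]

/-- The graph `joinedTriangles` without the triangle `a₁a₂a₃`. -/
def joinedStar : SimpleGraph (Fin 10) :=
  edgeListGraph [(0, 1), (0, 9), (1, 9), (3, 5), (3, 7), (5, 7), (4, 6), (4, 8), (6, 8),
    (7, 8), (7, 9), (8, 9), (1, 2), (2, 3), (2, 4)]

/-- The graph `joinedStar` with the edges of its star subdivided. The vertices are listed as
`c₁, a₁, w₁, x, w₂, w₃, a₂, a₃, c₂, c₃, b₂, b₃, b₁`, where `x` is the centre of the star. -/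
def joinedSubdividedStar : SimpleGraph (Fin 13) :=
  edgeListGraph [(0, 1), (0, 12), (1, 12), (6, 8), (6, 10), (8, 10), (7, 9), (7, 11), (9, 11),
    (10, 11), (10, 12), (11, 12), (1, 2), (2, 3), (3, 4), (3, 5), (4, 6), (5, 7)]

/-- A triangle `b₁b₂b₃` with triangles `aᵢbᵢcᵢ` for `i = 2, 3` and a path `b₁ya₁`, together with a
vertex `x` adjacent to all `aᵢ` and the edge `a₂a₃`. The vertices are listed as
`c₂, a₂, x, a₃, a₁, y, c₃, b₁, b₃, b₂`. -/
def joinedPath : SimpleGraph (Fin 10) :=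
  edgeListGraph [(0, 1), (0, 9), (1, 9), (3, 6), (3, 8), (6, 8), (7, 8), (7, 9), (8, 9),
    (4, 5), (5, 7), (1, 3), (1, 2), (2, 3), (2, 4)]

instance : DecidableRel joinedTriangles.Adj := inferInstanceAs (DecidableRel (edgeListGraph _).Adj)

instance : DecidableRel joinedStar.Adj := inferInstanceAs (DecidableRel (edgeListGraph _).Adj)

instance : DecidableRel joinedSubdividedStar.Adj :=
  inferInstanceAs (DecidableRel (edgeListGraph _).Adj)

instance : DecidableRel joinedPath.Adj := inferInstanceAs (DecidableRel (edgeListGraph _).Adj)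

/-- Every 2-connected claw-o-heavy and `P₆`-`γ`-heavy graph is hamiltonian. -/
def ForcesHamiltonian (γ : Set (Sym2 (Fin 6))) : Prop :=
  ∀ (V : Type) [Fintype V] [DecidableEq V] (G : SimpleGraph V) [DecidableRel G.Adj],
    TwoConnected G → ClawOHeavy G → P6GammaHeavy G γ → G.IsHamiltonian

variable {γ : Set (Sym2 (Fin 6))} {L : List (Fin 6 × Fin 6)}

theorem exists_not_mem_of_joinedTriangles (hsym : SymmetricalGamma γ) (hham : ForcesHamiltonian γ)
    (hL : P6HeavyOn joinedTriangles (fun _ => 1) L) : ¬ ∀ q ∈ L, s(q.1, q.2) ∈ γ := fun h =>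
  not_isHamiltonian_cliqueBlowUp (B := joinedTriangles) 1 0 9 3 7 5 4 8 6
    (by decide +kernel) (by decide +kernel) (by decide +kernel) (by decide +kernel)
    (by decide +kernel) (by decide +kernel) (by decide +kernel) (by decide +kernel)
    (by decide +kernel) (by decide +kernel) (by decide +kernel)
    (hham _ _ (twoConnected_cliqueBlowUp (N := 7) (by decide +kernel) (by decide +kernel)
        (by decide +kernel) (by decide +kernel) (by decide +kernel) (by decide +kernel))
      (clawOHeavy_cliqueBlowUp (by decide +kernel)) (hL.p6GammaHeavy hsym h))

theorem exists_not_mem_of_joinedStar (hsym : SymmetricalGamma γ) (hham : ForcesHamiltonian γ)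
    (hL : P6HeavyOn joinedStar ![1, 1, 5, 1, 1, 1, 1, 1, 1, 1] L) :
    ¬ ∀ q ∈ L, s(q.1, q.2) ∈ γ := fun h =>
  not_isHamiltonian_cliqueBlowUp (B := joinedStar) 1 0 9 3 7 5 4 8 6
    (by decide +kernel) (by decide +kernel) (by decide +kernel) (by decide +kernel)
    (by decide +kernel) (by decide +kernel) (by decide +kernel) (by decide +kernel)
    (by decide +kernel) (by decide +kernel) (by decide +kernel)
    (hham _ _ (twoConnected_cliqueBlowUp (N := 7) (by decide +kernel) (by decide +kernel)
        (by decide +kernel) (by decide +kernel) (by decide +kernel) (by decide +kernel))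
      (clawOHeavy_cliqueBlowUp (by decide +kernel)) (hL.p6GammaHeavy hsym h))

theorem exists_not_mem_of_joinedSubdividedStar (hsym : SymmetricalGamma γ)
    (hham : ForcesHamiltonian γ)
    (hL : P6HeavyOn joinedSubdividedStar ![1, 1, 8, 17, 8, 8, 1, 1, 1, 1, 1, 1, 1] L) :
    ¬ ∀ q ∈ L, s(q.1, q.2) ∈ γ := fun h =>
  not_isHamiltonian_cliqueBlowUp (B := joinedSubdividedStar) 1 0 12 6 10 8 7 11 9
    (by decide +kernel) (by decide +kernel) (by decide +kernel) (by decide +kernel)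
    (by decide +kernel) (by decide +kernel) (by decide +kernel) (by decide +kernel)
    (by decide +kernel) (by decide +kernel) (by decide +kernel)
    (hham _ _ (twoConnected_cliqueBlowUp (N := 10) (by decide +kernel) (by decide +kernel)
        (by decide +kernel) (by decide +kernel) (by decide +kernel) (by decide +kernel))
      (clawOHeavy_cliqueBlowUp (by decide +kernel)) (hL.p6GammaHeavy hsym h))

theorem exists_not_mem_of_joinedPath (hsym : SymmetricalGamma γ) (hham : ForcesHamiltonian γ)
    (hL : P6HeavyOn joinedPath ![1, 1, 6, 1, 1, 11, 1, 1, 1, 1] L) :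
    ¬ ∀ q ∈ L, s(q.1, q.2) ∈ γ := fun h =>
  not_isHamiltonian_cliqueBlowUp (B := joinedPath) 4 5 7 1 9 0 3 8 6
    (by decide +kernel) (by decide +kernel) (by decide +kernel) (by decide +kernel)
    (by decide +kernel) (by decide +kernel) (by decide +kernel) (by decide +kernel)
    (by decide +kernel) (by decide +kernel) (by decide +kernel)
    (hham _ _ (twoConnected_cliqueBlowUp (N := 7) (by decide +kernel) (by decide +kernel)
        (by decide +kernel) (by decide +kernel) (by decide +kernel) (by decide +kernel))
      (clawOHeavy_cliqueBlowUp (by decide +kernel)) (hL.p6GammaHeavy hsym h))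

end Patterns

/-- A symmetrical graph `γ` avoiding the pairs in `R` is a subgraph of `δ` as soon as each pair is
in `R`, up to reversal, or in `δ`. -/
theorem SymmetricalGamma.subset_of_forall_mem {γ δ : Set (Sym2 (Fin 6))}
    (hsym : SymmetricalGamma γ) (R : List (Sym2 (Fin 6))) (hR : ∀ e ∈ R, e ∉ γ)
    (h : ∀ e : Sym2 (Fin 6), e ∈ R ∨ e.map Fin.rev ∈ R ∨ e ∈ δ) : γ ⊆ δ := fun e he =>
  (h e).elim (fun h' => absurd he (hR e h')) fun h' =>
    h'.resolve_left fun h'' => hR _ h'' ((hsym e).1 he)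

set_option maxHeartbeats 1000000 in
/-- If `γ` is a symmetrical graph on `I` such that every 2-connected claw-o-heavy and
`P₆`-`γ`-heavy graph is hamiltonian, then `γ` is a subgraph of `γ₁`, of `γ₂`, or of `γ₃`. -/
theorem stmt_5 (γ : Set (Sym2 (Fin 6))) (hsym : SymmetricalGamma γ)
    (hham : ∀ (V : Type) [Fintype V] [DecidableEq V] (G : SimpleGraph V) [DecidableRel G.Adj],
      TwoConnected G → ClawOHeavy G → P6GammaHeavy G γ → G.IsHamiltonian) :
    γ ⊆ gamma1 ∨ γ ⊆ gamma2 ∨ γ ⊆ gamma3 := by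
  have triangles : ∀ i j, SimpleGraph.P6HeavyOn joinedTriangles (fun _ => 1) [(i, j)] →
      s(i, j) ∉ γ :=
    fun i j hL hij => exists_not_mem_of_joinedTriangles hsym hham hL (by simpa using hij)
  have star : ∀ i j k l, SimpleGraph.P6HeavyOn joinedStar
      ![1, 1, 5, 1, 1, 1, 1, 1, 1, 1] [(i, j), (k, l)] →
      ¬ (s(i, j) ∈ γ ∧ s(k, l) ∈ γ) :=
    fun i j k l hL h => exists_not_mem_of_joinedStar hsym hham hL (by simpa using h)
  have subdivided : ∀ i j k l, SimpleGraph.P6HeavyOn joinedSubdividedStar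
      ![1, 1, 8, 17, 8, 8, 1, 1, 1, 1, 1, 1, 1] [(i, j), (k, l)] →
      ¬ (s(i, j) ∈ γ ∧ s(k, l) ∈ γ) :=
    fun i j k l hL h => exists_not_mem_of_joinedSubdividedStar hsym hham hL (by simpa using h)
  have path : ∀ i j k l, SimpleGraph.P6HeavyOn joinedPath
      ![1, 1, 6, 1, 1, 11, 1, 1, 1, 1] [(i, j), (k, l)] →
      ¬ (s(i, j) ∈ γ ∧ s(k, l) ∈ γ) :=
    fun i j k l hL h => exists_not_mem_of_joinedPath hsym hham hL (by simpa using h)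
  have h22 := triangles 1 1 (by decide +kernel)
  have h33 := triangles 2 2 (by decide +kernel)
  have h23 := triangles 1 2 (by decide +kernel)
  have h24_11 := star 1 3 0 0 (by decide +kernel)
  have h24_12 := star 1 3 0 1 (by decide +kernel)
  have h24_13 := star 1 3 0 2 (by decide +kernel)
  have h34_11 := star 2 3 0 0 (by decide +kernel)
  have h34_12 := star 2 3 0 1 (by decide +kernel)
  have h34_13 := star 2 3 0 2 (by decide +kernel)
  have h13_16 := subdivided 0 2 0 5 (by decide +kernel)
  have h13_11 := subdivided 0 2 0 0 (by decide +kernel)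
  have h13_12 := path 0 2 0 1 (by decide +kernel)
  by_cases h13 : s(0, 2) ∈ γ
  · refine .inr (.inr (hsym.subset_of_forall_mem
      [s(1, 1), s(2, 2), s(1, 2), s(0, 0), s(0, 1), s(0, 5), s(1, 3), s(2, 3)] ?_ ?_))
    · simp only [List.mem_cons, List.not_mem_nil, or_false, forall_eq_or_imp, forall_eq]
      exact ⟨h22, h33, h23, fun h => h13_11 ⟨h13, h⟩, fun h => h13_12 ⟨h13, h⟩,
        fun h => h13_16 ⟨h13, h⟩, fun h => h24_13 ⟨h, h13⟩, fun h => h34_13 ⟨h, h13⟩⟩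
    · simp only [gamma3, Set.mem_insert_iff, Set.mem_singleton_iff]
      decide +kernel
  by_cases h : s(1, 3) ∈ γ ∨ s(2, 3) ∈ γ
  · refine .inl (hsym.subset_of_forall_mem
      [s(1, 1), s(2, 2), s(1, 2), s(0, 0), s(0, 1), s(0, 2)] ?_ ?_)
    · simp only [List.mem_cons, List.not_mem_nil, or_false, forall_eq_or_imp, forall_eq]
      exact ⟨h22, h33, h23, fun h' => h.elim (fun e => h24_11 ⟨e, h'⟩) fun e => h34_11 ⟨e, h'⟩,
        fun h' => h.elim (fun e => h24_12 ⟨e, h'⟩) fun e => h34_12 ⟨e, h'⟩, h13⟩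
    · simp only [gamma1, Set.mem_insert_iff, Set.mem_singleton_iff]
      decide +kernel
  · refine .inr (.inl (hsym.subset_of_forall_mem
      [s(1, 1), s(2, 2), s(1, 2), s(0, 2), s(1, 3), s(2, 3)] ?_ ?_))
    · simp only [List.mem_cons, List.not_mem_nil, or_false, forall_eq_or_imp, forall_eq]
      exact ⟨h22, h33, h23, h13, fun h' => h (.inl h'), fun h' => h (.inr h')⟩
    · simp only [gamma2, Set.mem_insert_iff, Set.mem_singleton_iff]
      decide +kernel
end
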